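/- There exist δ₀ > 0 and C > 0, depending only on p, μ, v_±, s and the profile ṽ, such that for every T > 0, every δ ≤ δ₀, and every classical solution (Φ,Ψ) of the integrated perturbation system on ℝ × [0,T] satisfying the a priori smallness assumption with parameter δ, for all t ∈ [0,T]: ‖(Φ_ξξ, Ψ_ξξ)(t)‖² + ∫₀ᵗ ∫_ℝ Φ_ξξξ² dξ dτ ≤ C ‖(Φ₀,Ψ₀)‖₂². -/

import Mathlib

open MeasureTheory Filter Topology Set

noncomputable section

noncomputable def L2sq (w : ℝ → ℝ) : ℝ := ∫ ξ : ℝ, (w ξ) ^ 2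

noncomputable def HkSq (k : ℕ) (w : ℝ → ℝ) : ℝ :=
  ∑ j ∈ Finset.range (k + 1), L2sq (iteratedDeriv j w)

noncomputable def pairHkSq (k : ℕ) (F G : ℝ → ℝ) : ℝ := HkSq k F + HkSq k G

/-- The nonlinear remainder `G = (g'(v) - g'(ṽ))Φ_ξξ + (g'(v) - g'(ṽ) - g''(ṽ)Φ_ξ)ṽ_ξ`
with `v = ṽ + Φ_ξ`. -/
noncomputable def Gterm (g tv φ : ℝ → ℝ) (ξ : ℝ) : ℝ :=
  (deriv g (tv ξ + deriv φ ξ) - deriv g (tv ξ)) * iteratedDeriv 2 φ ξ +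
    (deriv g (tv ξ + deriv φ ξ) - deriv g (tv ξ)
      - deriv (deriv g) (tv ξ) * deriv φ ξ) * deriv tv ξ

/-- The relative pressure `p(v|ṽ) = p(v) - p(ṽ) - p'(ṽ)(v - ṽ)` with `v = ṽ + Φ_ξ`. -/
noncomputable def prel (p tv φ : ℝ → ℝ) (ξ : ℝ) : ℝ :=
  p (tv ξ + deriv φ ξ) - p (tv ξ) - deriv p (tv ξ) * deriv φ ξ

/-- A classical solution of the integrated perturbation system on `ℝ × [0,T]`:
`C⁴` in `ξ`, `C¹` in `t` with continuous mixed derivatives `∂_t ∂_ξ^j` (`j ≤ 3`),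
satisfying both equations pointwise, with square-integrable `ξ`-derivatives up to order 4
(`L²`-norms continuous in `t`) and derivatives up to order 3 decaying at spatial infinity,
uniformly in `t`. -/
structure IsClassicalSolution (p g tv : ℝ → ℝ) (s T : ℝ) (Φ Ψ : ℝ → ℝ → ℝ) : Prop where
  regΦ : ∀ t ∈ Set.Icc (0:ℝ) T, ContDiff ℝ 4 (Φ t)
  regΨ : ∀ t ∈ Set.Icc (0:ℝ) T, ContDiff ℝ 4 (Ψ t)
  tdiffΦ : ∀ j : ℕ, j ≤ 3 → ∀ t ∈ Set.Icc (0:ℝ) T, ∀ ξ : ℝ,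
    DifferentiableAt ℝ (fun τ => iteratedDeriv j (Φ τ) ξ) t
  tdiffΨ : ∀ j : ℕ, j ≤ 3 → ∀ t ∈ Set.Icc (0:ℝ) T, ∀ ξ : ℝ,
    DifferentiableAt ℝ (fun τ => iteratedDeriv j (Ψ τ) ξ) t
  mixContΦ : ∀ j : ℕ, j ≤ 3 → ContinuousOn
    (fun q : ℝ × ℝ => deriv (fun τ => iteratedDeriv j (Φ τ) q.2) q.1)
    (Set.Icc (0:ℝ) T ×ˢ (Set.univ : Set ℝ))
  mixContΨ : ∀ j : ℕ, j ≤ 3 → ContinuousOn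
    (fun q : ℝ × ℝ => deriv (fun τ => iteratedDeriv j (Ψ τ) q.2) q.1)
    (Set.Icc (0:ℝ) T ×ˢ (Set.univ : Set ℝ))
  spContΦ : ∀ j : ℕ, j ≤ 4 → ContinuousOn
    (fun q : ℝ × ℝ => iteratedDeriv j (Φ q.1) q.2)
    (Set.Icc (0:ℝ) T ×ˢ (Set.univ : Set ℝ))
  spContΨ : ∀ j : ℕ, j ≤ 4 → ContinuousOn
    (fun q : ℝ × ℝ => iteratedDeriv j (Ψ q.1) q.2)
    (Set.Icc (0:ℝ) T ×ˢ (Set.univ : Set ℝ))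
  eq1 : ∀ t ∈ Set.Icc (0:ℝ) T, ∀ ξ : ℝ,
    deriv (fun τ => Φ τ ξ) t - s * deriv (Φ t) ξ - deriv (Ψ t) ξ
        - deriv g (tv ξ) * iteratedDeriv 2 (Φ t) ξ
        - deriv (deriv g) (tv ξ) * deriv tv ξ * deriv (Φ t) ξ
      = Gterm g tv (Φ t) ξ
  eq2 : ∀ t ∈ Set.Icc (0:ℝ) T, ∀ ξ : ℝ,
    deriv (fun τ => Ψ τ ξ) t - s * deriv (Ψ t) ξ + deriv p (tv ξ) * deriv (Φ t) ξ
      = -prel p tv (Φ t) ξ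
  sqIntΦ : ∀ j : ℕ, j ≤ 4 → ∀ t ∈ Set.Icc (0:ℝ) T,
    MeasureTheory.Integrable (fun ξ : ℝ => (iteratedDeriv j (Φ t) ξ) ^ 2)
  sqIntΨ : ∀ j : ℕ, j ≤ 4 → ∀ t ∈ Set.Icc (0:ℝ) T,
    MeasureTheory.Integrable (fun ξ : ℝ => (iteratedDeriv j (Ψ t) ξ) ^ 2)
  l2ContΦ : ∀ j : ℕ, j ≤ 4 →
    ContinuousOn (fun t => L2sq (iteratedDeriv j (Φ t))) (Set.Icc (0:ℝ) T)
  l2ContΨ : ∀ j : ℕ, j ≤ 4 →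
    ContinuousOn (fun t => L2sq (iteratedDeriv j (Ψ t))) (Set.Icc (0:ℝ) T)
  decayΦ : ∀ j : ℕ, j ≤ 3 → ∀ ε > (0:ℝ), ∃ R : ℝ, ∀ t ∈ Set.Icc (0:ℝ) T, ∀ ξ : ℝ,
    R ≤ |ξ| → |iteratedDeriv j (Φ t) ξ| < ε
  decayΨ : ∀ j : ℕ, j ≤ 3 → ∀ ε > (0:ℝ), ∃ R : ℝ, ∀ t ∈ Set.Icc (0:ℝ) T, ∀ ξ : ℝ,
    R ≤ |ξ| → |iteratedDeriv j (Ψ t) ξ| < ε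

lemma continuous_clamp {F : ℝ × ℝ → ℝ} {T : ℝ} (hT : 0 ≤ T)
    (hF : ContinuousOn F (Icc (0 : ℝ) T ×ˢ (univ : Set ℝ))) :
    Continuous fun q : ℝ × ℝ => F (max 0 (min q.1 T), q.2) :=
  hF.comp_continuous (by fun_prop) fun q =>
    ⟨⟨le_max_left _ _, max_le hT (min_le_right _ _)⟩, mem_univ _⟩

lemma clamp_eq {T t : ℝ} (ht : t ∈ Icc (0 : ℝ) T) : max 0 (min t T) = t := by
  rw [min_eq_left ht.2, max_eq_right ht.1]

lemma integral_increment_eq {T : ℝ} {a b : ℝ → ℝ → ℝ}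
    (hder : ∀ t ∈ Icc (0 : ℝ) T, ∀ x, HasDerivAt (fun τ => a τ x) (b t x) t)
    (hb : ContinuousOn (fun q : ℝ × ℝ => b q.1 q.2) (Icc (0 : ℝ) T ×ˢ (univ : Set ℝ)))
    {t : ℝ} (ht : t ∈ Icc (0 : ℝ) T) (x₁ x₂ : ℝ) :
    ∫ x in x₁..x₂, (a t x - a 0 x) =
      ∫ τ in (0 : ℝ)..t, ∫ x in x₁..x₂, b (max 0 (min τ T)) x := by
  have hT : 0 ≤ T := ht.1.trans ht.2
  have hc := continuous_clamp hT hb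
  have hx : ∀ x, a t x - a 0 x = ∫ τ in (0 : ℝ)..t, b (max 0 (min τ T)) x := by
    intro x
    have hcx : Continuous fun τ : ℝ => b (max 0 (min τ T)) x :=
      hc.comp (by fun_prop : Continuous fun τ : ℝ => (τ, x))
    symm
    apply intervalIntegral.integral_eq_sub_of_hasDerivAt (f := fun τ => a τ x)
    · intro τ hτ
      rw [uIcc_of_le ht.1] at hτ
      have hτ' : τ ∈ Icc (0 : ℝ) T := ⟨hτ.1, hτ.2.trans ht.2⟩
      rw [clamp_eq hτ']
      exact hder τ hτ' x
    · exact hcx.intervalIntegrable _ _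
  simp_rw [hx]
  refine intervalIntegral_intervalIntegral_swap (F := fun x τ => b (max 0 (min τ T)) x) ?_
  have hcs : Continuous (Function.uncurry fun x τ => b (max 0 (min τ T)) x) :=
    hc.comp continuous_swap
  exact (hcs.continuousOn.integrableOn_compact (isCompact_uIcc.prod isCompact_uIcc)).mono_set
    (prod_mono uIoc_subset_uIcc uIoc_subset_uIcc)

lemma continuous_integral_clamp {F : ℝ → ℝ → ℝ} {T : ℝ} (hT : 0 ≤ T)
    (hF : ContinuousOn (fun q : ℝ × ℝ => F q.1 q.2) (Icc (0 : ℝ) T ×ˢ (univ : Set ℝ)))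
    (x₁ x₂ : ℝ) : Continuous fun τ : ℝ => ∫ x in x₁..x₂, F (max 0 (min τ T)) x :=
  intervalIntegral.continuous_parametric_intervalIntegral_of_continuous'
    (continuous_clamp hT hF) _ _

/-- Mixed partial derivatives commute: if `a` has `x`-derivative `a'` and their `t`-derivatives
are `b` and `b'`, then `b` has `x`-derivative `b'`. -/
lemma hasDerivAt_mixed {T : ℝ} {a a' b b' : ℝ → ℝ → ℝ}
    (hx : ∀ t ∈ Icc (0 : ℝ) T, ∀ x, HasDerivAt (a t) (a' t x) x)
    (ha' : ∀ t ∈ Icc (0 : ℝ) T, Continuous (a' t))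
    (hb : ∀ t ∈ Icc (0 : ℝ) T, ∀ x, HasDerivAt (fun τ => a τ x) (b t x) t)
    (hb' : ∀ t ∈ Icc (0 : ℝ) T, ∀ x, HasDerivAt (fun τ => a' τ x) (b' t x) t)
    (hc : ContinuousOn (fun q : ℝ × ℝ => b' q.1 q.2) (Icc (0 : ℝ) T ×ˢ (univ : Set ℝ)))
    {t : ℝ} (ht : t ∈ Ioo (0 : ℝ) T) (x : ℝ) : HasDerivAt (b t) (b' t x) x := by
  have htc : t ∈ Icc (0 : ℝ) T := Ioo_subset_Icc_self ht
  have hT : 0 ≤ T := htc.1.trans htc.2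
  have h0 : (0 : ℝ) ∈ Icc (0 : ℝ) T := ⟨le_rfl, hT⟩
  have hbt : Continuous (b' t) := by
    have := (continuous_clamp hT hc).comp (by fun_prop : Continuous fun x : ℝ => (t, x))
    simpa [Function.comp_def, clamp_eq htc] using this
  have key : ∀ y, b t y = b t 0 + ∫ z in (0 : ℝ)..y, b' t z := by
    intro y
    have hR : HasDerivAt (fun τ => ∫ σ in (0 : ℝ)..τ, ∫ z in (0 : ℝ)..y, b' (max 0 (min σ T)) z)
        (∫ z in (0 : ℝ)..y, b' (max 0 (min t T)) z) t :=
      ((continuous_integral_clamp hT hc 0 y).integral_hasStrictDerivAt 0 t).hasDerivAt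
    rw [clamp_eq htc] at hR
    have hL : HasDerivAt (fun τ => (a τ y - a τ 0) - (a 0 y - a 0 0)) (b t y - b t 0) t :=
      ((hb t htc y).sub (hb t htc 0)).sub_const _
    have heq : (fun τ => (a τ y - a τ 0) - (a 0 y - a 0 0)) =ᶠ[𝓝 t]
        fun τ => ∫ σ in (0 : ℝ)..τ, ∫ z in (0 : ℝ)..y, b' (max 0 (min σ T)) z := by
      filter_upwards [Ioo_mem_nhds ht.1 ht.2] with τ hτ
      have hτ' := Ioo_subset_Icc_self hτ
      rw [← integral_increment_eq hb' hc hτ', intervalIntegral.integral_sub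
        ((ha' τ hτ').intervalIntegrable _ _) ((ha' 0 h0).intervalIntegrable _ _),
        intervalIntegral.integral_eq_sub_of_hasDerivAt (fun z _ => hx τ hτ' z)
          ((ha' τ hτ').intervalIntegrable _ _),
        intervalIntegral.integral_eq_sub_of_hasDerivAt (fun z _ => hx 0 h0 z)
          ((ha' 0 h0).intervalIntegrable _ _)]
    have := hL.unique (hR.congr_of_eventuallyEq heq)
    linarith
  have : b t = fun y => b t 0 + ∫ z in (0 : ℝ)..y, b' t z := funext key
  rw [this]
  exact ((hbt.integral_hasStrictDerivAt 0 x).hasDerivAt).const_add _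

/-- The integrated form of the pointwise balance `e_t + d ≤ H_ξ`, where the flux `H` vanishes at
infinity uniformly in time. -/
lemma integral_energy_le {T : ℝ} {e et d H Hx : ℝ → ℝ → ℝ}
    (het : ∀ t ∈ Icc (0 : ℝ) T, ∀ x, HasDerivAt (fun τ => e τ x) (et t x) t)
    (hetc : ContinuousOn (fun q : ℝ × ℝ => et q.1 q.2) (Icc (0 : ℝ) T ×ˢ (univ : Set ℝ)))
    (hdc : ContinuousOn (fun q : ℝ × ℝ => d q.1 q.2) (Icc (0 : ℝ) T ×ˢ (univ : Set ℝ)))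
    (hd : ∀ t x, 0 ≤ d t x)
    (hei : ∀ t ∈ Icc (0 : ℝ) T, Integrable (e t))
    (hdi : ∀ t ∈ Icc (0 : ℝ) T, Integrable (d t))
    (hdint : ContinuousOn (fun t => ∫ x, d t x) (Icc (0 : ℝ) T))
    (hHx : ∀ t ∈ Ioo (0 : ℝ) T, ∀ x, HasDerivAt (H t) (Hx t x) x)
    (hle : ∀ t ∈ Ioo (0 : ℝ) T, ∀ x, et t x + d t x ≤ Hx t x)
    (hdecay : ∀ ε > (0 : ℝ), ∃ R : ℝ, ∀ t ∈ Icc (0 : ℝ) T, ∀ x, R ≤ |x| → |H t x| < ε)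
    {t : ℝ} (ht : t ∈ Icc (0 : ℝ) T) :
    (∫ x, e t x) + ∫ τ in (0 : ℝ)..t, ∫ x, d τ x ≤ ∫ x, e 0 x := by
  have hT : 0 ≤ T := ht.1.trans ht.2
  have h0 : (0 : ℝ) ∈ Icc (0 : ℝ) T := ⟨le_rfl, hT⟩
  have hsub : Icc (0 : ℝ) t ⊆ Icc 0 T := Icc_subset_Icc_right ht.2
  have hslice : ∀ {F : ℝ → ℝ → ℝ}, ContinuousOn (fun q : ℝ × ℝ => F q.1 q.2)
      (Icc (0 : ℝ) T ×ˢ (univ : Set ℝ)) → ∀ τ ∈ Icc (0 : ℝ) T, Continuous (F τ) := by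
    intro F hF τ hτ
    have := (continuous_clamp hT hF).comp (by fun_prop : Continuous fun x : ℝ => (τ, x))
    simpa [Function.comp_def, clamp_eq hτ] using this
  have hbot : Tendsto (fun n : ℕ => -(n : ℝ)) atTop atBot :=
    tendsto_neg_atTop_atBot.comp tendsto_natCast_atTop_atTop
  have hlim : Tendsto (fun n : ℕ => ∫ τ in (0 : ℝ)..t, ∫ x in (-(n : ℝ))..n,
      d (max 0 (min τ T)) x) atTop (𝓝 (∫ τ in (0 : ℝ)..t, ∫ x, d τ x)) := by
    refine intervalIntegral.tendsto_integral_filter_of_dominated_convergence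
      (fun τ => ∫ x, d τ x) ?_ ?_ ?_ ?_
    · exact Eventually.of_forall fun n =>
        (continuous_integral_clamp hT hdc _ _).aestronglyMeasurable
    · refine Eventually.of_forall fun n => Eventually.of_forall fun τ hτ => ?_
      rw [uIoc_of_le ht.1] at hτ
      have hτ' : τ ∈ Icc (0 : ℝ) T := hsub (Ioc_subset_Icc_self hτ)
      have hn : (-(n : ℝ)) ≤ n := by linarith [n.cast_nonneg (α := ℝ)]
      rw [clamp_eq hτ', Real.norm_of_nonneg
        (intervalIntegral.integral_nonneg hn fun x _ => hd τ x),
        intervalIntegral.integral_of_le hn]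
      exact setIntegral_le_integral (hdi τ hτ') (Eventually.of_forall (hd τ))
    · exact (hdint.mono (by rwa [uIcc_of_le ht.1])).intervalIntegrable
    · refine Eventually.of_forall fun τ hτ => ?_
      rw [uIoc_of_le ht.1] at hτ
      have hτ' : τ ∈ Icc (0 : ℝ) T := hsub (Ioc_subset_Icc_self hτ)
      rw [clamp_eq hτ']
      exact intervalIntegral_tendsto_integral (hdi τ hτ') hbot tendsto_natCast_atTop_atTop
  have hlime : ∀ τ ∈ Icc (0 : ℝ) T, Tendsto (fun n : ℕ => ∫ x in (-(n : ℝ))..n, e τ x) atTop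
      (𝓝 (∫ x, e τ x)) := fun τ hτ =>
    intervalIntegral_tendsto_integral (hei τ hτ) hbot tendsto_natCast_atTop_atTop
  have hε : ∀ ε > (0 : ℝ), (∫ x, e t x) + ∫ τ in (0 : ℝ)..t, ∫ x, d τ x
      ≤ (∫ x, e 0 x) + 2 * ε * t := by
    intro ε hε
    obtain ⟨R, hR⟩ := hdecay ε hε
    refine le_of_tendsto_of_tendsto ((hlime t ht).add hlim) ((hlime 0 h0).add_const _) ?_
    filter_upwards [tendsto_natCast_atTop_atTop.eventually (eventually_ge_atTop R)] with n hnR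
    have hn : (-(n : ℝ)) ≤ n := by linarith [n.cast_nonneg (α := ℝ)]
    have hinc := integral_increment_eq het hetc ht (-(n : ℝ)) n
    rw [intervalIntegral.integral_sub (hei t ht).intervalIntegrable
      (hei 0 h0).intervalIntegrable] at hinc
    have hmono : ∫ τ in (0 : ℝ)..t, ((∫ x in (-(n : ℝ))..n, et (max 0 (min τ T)) x) +
        ∫ x in (-(n : ℝ))..n, d (max 0 (min τ T)) x) ≤ ∫ τ in (0 : ℝ)..t, 2 * ε := by
      refine intervalIntegral.integral_mono_on_of_le_Ioo ht.1
        (((continuous_integral_clamp hT hetc _ _).add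
          (continuous_integral_clamp hT hdc _ _)).intervalIntegrable _ _)
        (continuous_const.intervalIntegrable _ _) fun τ hτ => ?_
      have hτ' : τ ∈ Ioo (0 : ℝ) T := ⟨hτ.1, hτ.2.trans_le ht.2⟩
      have hτc := Ioo_subset_Icc_self hτ'
      rw [clamp_eq hτc, ← intervalIntegral.integral_add
        ((hslice hetc τ hτc).intervalIntegrable _ _) ((hslice hdc τ hτc).intervalIntegrable _ _)]
      have h1 := intervalIntegral.integral_le_sub_of_hasDeriv_right_of_le hn
        (fun x _ => (hHx τ hτ' x).continuousAt.continuousWithinAt)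
        (fun x _ => (hHx τ hτ' x).hasDerivWithinAt)
        (((hslice hetc τ hτc).add (hslice hdc τ hτc)).continuousOn.integrableOn_compact
          isCompact_Icc) (fun x _ => hle τ hτ' x)
      have h2 := (abs_lt.1 (hR τ hτc n (by simpa using hnR))).2
      have h3 := (abs_lt.1 (hR τ hτc (-(n : ℝ)) (by simpa using hnR))).1
      simp only [Pi.add_apply] at h1
      linarith
    rw [intervalIntegral.integral_add
      ((continuous_integral_clamp hT hetc _ _).intervalIntegrable _ _)
      ((continuous_integral_clamp hT hdc _ _).intervalIntegrable _ _), ← hinc,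
      intervalIntegral.integral_const, smul_eq_mul] at hmono
    linarith
  refine le_of_forall_pos_le_add fun η hη => ?_
  have h := hε (η / (2 * (t + 1))) (by have := ht.1; positivity)
  have : 2 * (η / (2 * (t + 1))) * t ≤ η := by
    have := ht.1
    rw [show 2 * (η / (2 * (t + 1))) * t = η * t / (t + 1) by field_simp, div_le_iff₀ (by linarith)]
    nlinarith
  linarith

/-- One-dimensional Sobolev inequality. -/
lemma sq_le_integral_sq_add {w w' : ℝ → ℝ} (hw : ∀ x, HasDerivAt w (w' x) x)
    (hw' : Continuous w') (hi : Integrable fun x => w x ^ 2) (hi' : Integrable fun x => w' x ^ 2)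
    (hdecay : ∀ ε > (0 : ℝ), ∃ R : ℝ, ∀ x, R ≤ |x| → |w x| < ε) (x : ℝ) :
    w x ^ 2 ≤ (∫ y, w y ^ 2) + ∫ y, w' y ^ 2 := by
  have hwc : Continuous w := continuous_iff_continuousAt.2 fun y => (hw y).continuousAt
  refine le_of_forall_pos_le_add fun η hη => ?_
  obtain ⟨R, hR⟩ := hdecay (Real.sqrt η) (Real.sqrt_pos.2 hη)
  set y := -max |R| |x|
  have hyx : y ≤ x := (neg_le_neg (le_max_right _ _)).trans (neg_abs_le x)
  have hy : w y ^ 2 ≤ η := by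
    have h := hR y (by
      rw [abs_neg, abs_of_nonneg (le_max_of_le_left (abs_nonneg R))]
      exact (le_abs_self R).trans (le_max_left _ _))
    rw [← Real.sq_sqrt hη.le, ← sq_abs (w y)]
    gcongr
  have h1 : w x ^ 2 - w y ^ 2 ≤ ∫ z in y..x, (w z ^ 2 + w' z ^ 2) := by
    have hd : ∀ z, HasDerivAt (fun z => w z ^ 2) (2 * w z * w' z) z := fun z => by
      simpa using (hw z).fun_pow 2
    rw [← intervalIntegral.integral_eq_sub_of_hasDerivAt (fun z _ => hd z)
      ((by fun_prop : Continuous fun z => 2 * w z * w' z).intervalIntegrable _ _)]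
    refine intervalIntegral.integral_mono_on hyx
      ((by fun_prop : Continuous fun z => 2 * w z * w' z).intervalIntegrable _ _)
      ((by fun_prop : Continuous fun z => w z ^ 2 + w' z ^ 2).intervalIntegrable _ _) fun z _ => ?_
    nlinarith [sq_nonneg (w z - w' z)]
  have h2 : ∫ z in y..x, (w z ^ 2 + w' z ^ 2) ≤ ∫ z, (w z ^ 2 + w' z ^ 2) := by
    rw [intervalIntegral.integral_of_le hyx]
    exact setIntegral_le_integral (hi.add hi') (Eventually.of_forall fun z => by positivity)
  rw [integral_add hi hi'] at h2
  linarith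

/-- First-order Taylor estimate on a convex set. -/
lemma abs_sub_sub_mul_le {S : Set ℝ} (hS : Convex ℝ S) {h h' h'' : ℝ → ℝ} {M : ℝ}
    (hd : ∀ x ∈ S, HasDerivAt h (h' x) x) (hd' : ∀ x ∈ S, HasDerivAt h' (h'' x) x)
    (hM : ∀ x ∈ S, |h'' x| ≤ M) {x y : ℝ} (hx : x ∈ S) (hy : y ∈ S) :
    |h y - h x - h' x * (y - x)| ≤ M * (y - x) ^ 2 := by
  have hseg : segment ℝ x y ⊆ S := hS.segment_subset hx hy
  have hconv : Convex ℝ (segment ℝ x y) := convex_segment x y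
  have hb : ∀ z ∈ segment ℝ x y, ‖h' z - h' x‖ ≤ M * |y - x| := by
    intro z hz
    have h1 := hconv.norm_image_sub_le_of_norm_hasDerivWithin_le
      (fun u hu => (hd' u (hseg hu)).hasDerivWithinAt) (fun u hu => hM u (hseg hu))
      (left_mem_segment ℝ x y) hz
    refine h1.trans ?_
    have hM0 : 0 ≤ M := (abs_nonneg _).trans (hM x hx)
    gcongr
    rw [segment_eq_uIcc] at hz
    exact abs_sub_left_of_mem_uIcc hz
  have h2 := hconv.norm_image_sub_le_of_norm_hasDerivWithin_le
    (f := fun z => h z - h' x * z) (f' := fun z => h' z - h' x)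
    (fun u hu => by
      simpa using ((hd u (hseg hu)).fun_sub ((hasDerivAt_id u).const_mul (h' x))).hasDerivWithinAt)
    hb (left_mem_segment ℝ x y) (right_mem_segment ℝ x y)
  have h3 : M * |y - x| * ‖y - x‖ = M * (y - x) ^ 2 := by
    rw [Real.norm_eq_abs, mul_assoc, ← sq, sq_abs]
  rw [h3] at h2
  convert h2 using 1
  rw [Real.norm_eq_abs]
  congr 1
  ring

/-- Glaeser's inequality for nonnegative functions with bounded second derivative. -/
lemma sq_deriv_le_of_nonneg {S : Set ℝ} (hS : Convex ℝ S) {h h' h'' : ℝ → ℝ} {M r : ℝ}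
    (hr : 0 < r) (hM1 : 0 < M) (hd : ∀ x ∈ S, HasDerivAt h (h' x) x)
    (hd' : ∀ x ∈ S, HasDerivAt h' (h'' x) x) (hM' : ∀ x ∈ S, |h' x| ≤ M)
    (hM : ∀ x ∈ S, |h'' x| ≤ M) (hnn : ∀ x ∈ S, 0 ≤ h x) {x : ℝ}
    (hx : ∀ y, |y| ≤ r → x + y ∈ S) :
    h' x ^ 2 ≤ 4 * M * (1 + 1 / r) * h x := by
  have hxS : x ∈ S := by simpa using hx 0 (by simpa using hr.le)
  have hpos : 0 < 2 * M * (1 + 1 / r) := by positivity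
  set η := 1 / (2 * M * (1 + 1 / r)) with hη
  have hη0 : 0 < η := by positivity
  have hη1 : η * M ≤ 1 / 2 := by
    rw [hη, div_mul_eq_mul_div, div_le_iff₀ hpos]
    have : 0 < 1 / r := by positivity
    nlinarith
  have hη2 : η * M ≤ r := by
    have : η * (2 * M * (1 + 1 / r)) = 1 := by rw [hη]; field_simp
    have h2 : η * M * (r + 1) * 2 = r := by
      have e : η * M * (r + 1) * 2 = η * (2 * M * (1 + 1 / r)) * r := by field_simp
      rw [e, this, one_mul]
    nlinarith [mul_pos hη0 hM1, mul_pos (mul_pos hη0 hM1) hr]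
  have hy : |-(η * h' x)| ≤ r := by
    rw [abs_neg, abs_mul, abs_of_pos hη0]
    exact (mul_le_mul_of_nonneg_left (hM' x hxS) hη0.le).trans hη2
  have h1 := (abs_le.1 (abs_sub_sub_mul_le hS hd hd' hM hxS (hx _ hy))).2
  have h2 := hnn _ (hx _ hy)
  have h3 : η * h' x ^ 2 / 2 ≤ h x := by
    have : M * (x + -(η * h' x) - x) ^ 2 = (η * M) * (η * h' x ^ 2) := by ring
    have h4 : (η * M) * (η * h' x ^ 2) ≤ 1 / 2 * (η * h' x ^ 2) := by gcongr
    nlinarith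
  rw [hη, div_mul_eq_mul_div, one_mul, div_div, div_le_iff₀ (by positivity)] at h3
  linarith

lemma contDiffOn_iterate_deriv {h : ℝ → ℝ} (hh : ContDiffOn ℝ (⊤ : ℕ∞) h (Ioi 0)) (n : ℕ) :
    ContDiffOn ℝ (⊤ : ℕ∞) (deriv^[n] h) (Ioi 0) := by
  induction n with
  | zero => simpa using hh
  | succ n ih =>
    rw [Function.iterate_succ_apply']
    exact ih.deriv_of_isOpen isOpen_Ioi (by norm_cast)

lemma hasDerivAt_iterate_deriv {h : ℝ → ℝ} (hh : ContDiffOn ℝ (⊤ : ℕ∞) h (Ioi 0)) (n : ℕ)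
    {x : ℝ} (hx : 0 < x) : HasDerivAt (deriv^[n] h) (deriv^[n + 1] h x) x := by
  rw [Function.iterate_succ_apply']
  exact (((contDiffOn_iterate_deriv hh n).contDiffAt (isOpen_Ioi.mem_nhds hx)).differentiableAt
    (by simp)).hasDerivAt

lemma exists_abs_iterate_deriv_le {h : ℝ → ℝ} (hh : ContDiffOn ℝ (⊤ : ℕ∞) h (Ioi 0))
    {a b : ℝ} (ha : 0 < a) (N : ℕ) :
    ∃ K : ℝ, 1 ≤ K ∧ ∀ n ≤ N, ∀ x ∈ Icc a b, |deriv^[n] h x| ≤ K := by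
  have h1 : ∀ n, ∃ K : ℝ, ∀ x ∈ Icc a b, |deriv^[n] h x| ≤ K := fun n => by
    have := isCompact_Icc.exists_bound_of_continuousOn
      ((contDiffOn_iterate_deriv hh n).continuousOn.mono
        (fun x (hx : x ∈ Icc a b) => ha.trans_le hx.1))
    simpa using this
  choose K hK using h1
  refine ⟨1 + ∑ n ∈ Finset.range (N + 1), |K n|,
    le_add_of_nonneg_right (Finset.sum_nonneg fun _ _ => abs_nonneg _), fun n hn x hx => ?_⟩
  have := Finset.single_le_sum (f := fun n => |K n|) (fun _ _ => abs_nonneg _)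
    (Finset.mem_range.2 (Nat.lt_succ_of_le hn))
  linarith [hK n x hx, le_abs_self (K n)]

/-- Uniform bounds for `h` and its derivatives near the profile `tv`. -/
structure ProfileBounds (h tv : ℝ → ℝ) (ρ K : ℝ) : Prop where
  bdd : ∀ n ≤ 3, ∀ ξ y, |y| ≤ ρ → |deriv^[n] h (tv ξ + y)| ≤ K
  lip : ∀ n ≤ 2, ∀ ξ y, |y| ≤ ρ → |deriv^[n] h (tv ξ + y) - deriv^[n] h (tv ξ)| ≤ K * |y|
  taylor : ∀ n ≤ 2, ∀ ξ y, |y| ≤ ρ →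
    |deriv^[n] h (tv ξ + y) - deriv^[n] h (tv ξ) - deriv^[n + 1] h (tv ξ) * y| ≤ K * y ^ 2

lemma ProfileBounds.mono {h tv : ℝ → ℝ} {ρ K K' : ℝ} (H : ProfileBounds h tv ρ K)
    (hK : K ≤ K') : ProfileBounds h tv ρ K' where
  bdd n hn ξ y hy := (H.bdd n hn ξ y hy).trans hK
  lip n hn ξ y hy := (H.lip n hn ξ y hy).trans (by gcongr)
  taylor n hn ξ y hy := (H.taylor n hn ξ y hy).trans (by gcongr)

lemma exists_profileBounds {h tv : ℝ → ℝ} (hh : ContDiffOn ℝ (⊤ : ℕ∞) h (Ioi 0))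
    {a b ρ : ℝ} (ha : 0 < a) (hρ : 0 < ρ)
    (htv : ∀ ξ y, |y| ≤ ρ → tv ξ + y ∈ Icc a b) :
    ∃ K : ℝ, ProfileBounds h tv ρ K := by
  obtain ⟨K, -, hK⟩ := exists_abs_iterate_deriv_le hh ha (b := b) 4
  have hd : ∀ n, ∀ x ∈ Icc a b, HasDerivAt (deriv^[n] h) (deriv^[n + 1] h x) x :=
    fun n x hx => hasDerivAt_iterate_deriv hh n (ha.trans_le hx.1)
  have htv0 : ∀ ξ, tv ξ ∈ Icc a b := fun ξ => by
    simpa using htv ξ 0 (by simpa using hρ.le)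
  refine ⟨K, fun n hn ξ y hy => hK n (by omega) _ (htv ξ y hy), fun n hn ξ y hy => ?_,
    fun n hn ξ y hy => ?_⟩
  · simpa using (convex_Icc a b).norm_image_sub_le_of_norm_hasDerivWithin_le
      (fun x hx => (hd n x hx).hasDerivWithinAt) (fun x hx => hK (n + 1) (by omega) x hx)
      (htv0 ξ) (htv ξ y hy)
  · simpa using abs_sub_sub_mul_le (convex_Icc a b) (hd n) (hd (n + 1))
      (fun x hx => hK (n + 2) (by omega) x hx) (htv0 ξ) (htv ξ y hy)

/-- Bounds on the coefficients of the perturbation system. -/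
structure CoefficientBounds (p g tv : ℝ → ℝ) (ρ K κ : ℝ) : Prop where
  ρ_pos : 0 < ρ
  κ_pos : 0 < κ
  one_le : 1 ≤ K
  pos : ∀ ξ y, |y| ≤ ρ → 0 < tv ξ + y
  bounds_g : ProfileBounds g tv ρ K
  bounds_p : ProfileBounds p tv ρ K
  dg_ge : ∀ ξ y, |y| ≤ ρ → κ ≤ deriv g (tv ξ + y)
  g_mono : ∀ ξ y, |y| ≤ ρ → κ * y ^ 2 ≤ y * (g (tv ξ + y) - g (tv ξ))
  dp_le : ∀ ξ, deriv p (tv ξ) ≤ -κ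
  ddp_nonneg : ∀ ξ, 0 ≤ deriv (deriv p) (tv ξ)
  dddp_sq : ∀ ξ, deriv (deriv (deriv p)) (tv ξ) ^ 2 ≤ K * deriv (deriv p) (tv ξ)
  dtv_neg : ∀ ξ, deriv tv ξ < 0
  dtv_le : ∀ ξ, |deriv tv ξ| ≤ K
  ddtv_le : ∀ ξ, |deriv (deriv tv) ξ| ≤ K
  ddtv_sq : ∀ ξ, deriv (deriv tv) ξ ^ 2 ≤ K * -deriv tv ξ

lemma exists_pos_le_of_continuousOn {f : ℝ → ℝ} {a b : ℝ} (hf : ContinuousOn f (Icc a b))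
    (hpos : ∀ x ∈ Icc a b, 0 < f x) : ∃ κ > (0 : ℝ), ∀ x ∈ Icc a b, κ ≤ f x := by
  rcases (Icc a b).eq_empty_or_nonempty with h | h
  · exact ⟨1, one_pos, by simp [h]⟩
  · obtain ⟨x, hx, hmin⟩ := isCompact_Icc.exists_isMinOn h hf
    exact ⟨f x, hpos x hx, fun y hy => hmin hy⟩

lemma mul_sq_le_mul_sub {S : Set ℝ} (hS : Convex ℝ S) {h h' : ℝ → ℝ} {κ : ℝ}
    (hd : ∀ x ∈ S, HasDerivAt h (h' x) x) (hκ : ∀ x ∈ S, κ ≤ h' x) {x y : ℝ}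
    (hx : x ∈ S) (hy : x + y ∈ S) : κ * y ^ 2 ≤ y * (h (x + y) - h x) := by
  have key : ∀ u ∈ S, ∀ v ∈ S, u ≤ v → κ * (v - u) ≤ h v - h u :=
    hS.mul_sub_le_image_sub_of_le_deriv (fun u hu => (hd u hu).continuousAt.continuousWithinAt)
      (fun u hu => (hd u (interior_subset hu)).differentiableAt.differentiableWithinAt)
      fun u hu => by
        rw [(hd u (interior_subset hu)).deriv]
        exact hκ u (interior_subset hu)
  rcases le_total 0 y with h0 | h0
  · have := key x hx _ hy (by linarith)
    nlinarith
  · have := key _ hy x hx (by linarith)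
    nlinarith

lemma exists_coefficientBounds
    {p : ℝ → ℝ} (hp_smooth : ContDiffOn ℝ (⊤ : ℕ∞) p (Set.Ioi 0))
    (hpd : ∀ v ∈ Set.Ioi (0:ℝ), deriv p v < 0)
    (hpdd : ∀ v ∈ Set.Ioi (0:ℝ), 0 ≤ deriv (deriv p) v)
    {μ : ℝ → ℝ} (hmu_smooth : ContDiffOn ℝ (⊤ : ℕ∞) μ (Set.Ioi 0))
    (hmu_pos : ∀ v ∈ Set.Ioi (0:ℝ), 0 < μ v)
    {vp vm : ℝ} (hvp : 0 < vp)
    {g : ℝ → ℝ} (hg : ∀ z ∈ Set.Ioi (0:ℝ), HasDerivAt g (μ z / z) z)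
    {tv : ℝ → ℝ} (htv_smooth : ContDiff ℝ (⊤ : ℕ∞) tv)
    (htv_mem : ∀ ξ : ℝ, tv ξ ∈ Set.Ioo vp vm)
    (htv_dec : ∀ ξ : ℝ, deriv tv ξ < 0)
    (htv_bdd : ∀ k : ℕ, ∃ M : ℝ, ∀ ξ : ℝ, |iteratedDeriv k tv ξ| ≤ M) :
    ContDiffOn ℝ (⊤ : ℕ∞) g (Ioi 0) ∧
      ∃ ρ K κ : ℝ, CoefficientBounds p g tv ρ K κ := by
  have hdg : ∀ z ∈ Ioi (0 : ℝ), deriv g z = μ z / z := fun z hz => (hg z hz).deriv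
  have hg_smooth : ContDiffOn ℝ (⊤ : ℕ∞) g (Ioi 0) := by
    rw [contDiffOn_infty_iff_deriv_of_isOpen isOpen_Ioi]
    exact ⟨fun z hz => (hg z hz).differentiableAt.differentiableWithinAt,
      (hmu_smooth.div contDiffOn_id fun z hz => (ne_of_gt hz : z ≠ 0)).congr hdg⟩
  refine ⟨hg_smooth, ?_⟩
  set a := vp / 2 with ha_def
  set b := vm + vp / 2 with hb_def
  have ha : 0 < a := by positivity
  have hmem : ∀ ξ y, |y| ≤ a → tv ξ + y ∈ Icc a b := fun ξ y hy => by
    have := htv_mem ξ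
    have := abs_le.1 hy
    constructor <;> linarith [this.1, this.2, (htv_mem ξ).1, (htv_mem ξ).2]
  have hmem0 : ∀ ξ, tv ξ ∈ Icc a b := fun ξ => by
    simpa using hmem ξ 0 (by simpa using ha.le)
  have hIcc : ∀ x ∈ Icc a b, 0 < x := fun x hx => ha.trans_le hx.1
  have hcont : ∀ {h : ℝ → ℝ}, ContDiffOn ℝ (⊤ : ℕ∞) h (Ioi 0) → ContinuousOn (deriv h) (Icc a b) :=
    fun hh => (contDiffOn_iterate_deriv hh 1).continuousOn.mono hIcc
  obtain ⟨Kg, hKg⟩ := exists_profileBounds hg_smooth ha ha hmem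
  obtain ⟨Kp, hKp⟩ := exists_profileBounds hp_smooth ha ha hmem
  obtain ⟨κg, hκg0, hκg⟩ := exists_pos_le_of_continuousOn (hcont hg_smooth) fun x hx => by
    rw [hdg x (hIcc x hx)]
    exact div_pos (hmu_pos x (hIcc x hx)) (hIcc x hx)
  obtain ⟨κp, hκp0, hκp⟩ := exists_pos_le_of_continuousOn (hcont hp_smooth).neg fun x hx =>
    neg_pos.2 (hpd x (hIcc x hx))
  have hglaeser_p : ∃ M, ∀ ξ, deriv (deriv (deriv p)) (tv ξ) ^ 2
      ≤ M * deriv (deriv p) (tv ξ) := by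
    obtain ⟨M, hM1, hM⟩ := exists_abs_iterate_deriv_le hp_smooth ha (b := b) 4
    exact ⟨_, fun ξ => sq_deriv_le_of_nonneg (convex_Icc a b) ha (zero_lt_one.trans_le hM1)
      (fun x hx => hasDerivAt_iterate_deriv hp_smooth 2 (hIcc x hx))
      (fun x hx => hasDerivAt_iterate_deriv hp_smooth 3 (hIcc x hx))
      (hM 3 (by norm_num)) (hM 4 le_rfl) (fun x hx => hpdd x (hIcc x hx)) (hmem ξ)⟩
  have htvd : ∀ n x, HasDerivAt (iteratedDeriv n tv) (iteratedDeriv (n + 1) tv x) x := by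
    intro n x
    rw [iteratedDeriv_succ]
    exact ((htv_smooth.differentiable_iteratedDeriv n (by
      exact_mod_cast ENat.natCast_lt_top n)) x).hasDerivAt
  choose M hM using htv_bdd
  have hglaeser_tv : ∃ C, ∀ ξ, deriv (deriv tv) ξ ^ 2 ≤ C * -deriv tv ξ := by
    have hM0 : 0 < 1 + |M 2| + |M 3| := by positivity
    refine ⟨4 * (1 + |M 2| + |M 3|) * (1 + 1 / 1), fun ξ => ?_⟩
    have := sq_deriv_le_of_nonneg (S := univ) convex_univ one_pos hM0
      (h := fun x => -iteratedDeriv 1 tv x) (fun x _ => (htvd 1 x).neg)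
      (fun x _ => (htvd 2 x).neg)
      (fun x _ => by
        rw [abs_neg]
        linarith [hM 2 x, le_abs_self (M 2), abs_nonneg (M 3)])
      (fun x _ => by
        rw [abs_neg]
        linarith [hM 3 x, le_abs_self (M 3), abs_nonneg (M 2)])
      (fun x _ => by simpa using (htv_dec x).le) (x := ξ) (fun _ _ => mem_univ _)
    simpa [iteratedDeriv_succ, iteratedDeriv_zero] using this
  obtain ⟨Mp, hMp⟩ := hglaeser_p
  obtain ⟨Mt, hMt⟩ := hglaeser_tv
  set K := 1 + |Kg| + |Kp| + |Mp| + |Mt| + |M 1| + |M 2| with hK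
  have := abs_nonneg Kg
  have := abs_nonneg Kp
  have := abs_nonneg Mp
  have := abs_nonneg Mt
  have := abs_nonneg (M 1)
  have := abs_nonneg (M 2)
  refine ⟨a, K, min κg κp, ha, lt_min hκg0 hκp0, by linarith, fun ξ y hy => hIcc _ (hmem ξ y hy),
    hKg.mono (by linarith [le_abs_self Kg]), hKp.mono (by linarith [le_abs_self Kp]),
    fun ξ y hy => (min_le_left _ _).trans (hκg _ (hmem ξ y hy)), fun ξ y hy => ?_,
    fun ξ => ?_, fun ξ => hpdd _ (hIcc _ (hmem0 ξ)), fun ξ => ?_, htv_dec, fun ξ => ?_,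
    fun ξ => ?_, fun ξ => ?_⟩
  · exact mul_sq_le_mul_sub (convex_Icc a b)
      (fun x hx => hasDerivAt_iterate_deriv hg_smooth 0 (hIcc x hx))
      (fun x hx => (min_le_left _ _).trans (hκg x hx)) (hmem0 ξ) (hmem ξ y hy)
  · have := hκp _ (hmem0 ξ)
    simp only [Pi.neg_apply] at this
    linarith [min_le_right κg κp]
  · refine (hMp ξ).trans (mul_le_mul_of_nonneg_right ?_ (hpdd _ (hIcc _ (hmem0 ξ))))
    linarith [le_abs_self Mp]
  · have := hM 1 ξ
    rw [iteratedDeriv_one] at this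
    linarith [le_abs_self (M 1)]
  · have := hM 2 ξ
    rw [iteratedDeriv_succ, iteratedDeriv_one] at this
    linarith [le_abs_self (M 2)]
  · refine (hMt ξ).trans (mul_le_mul_of_nonneg_right ?_ (neg_nonneg.2 (htv_dec ξ).le))
    linarith [le_abs_self Mt]

lemma abs_mul_le_of_le {a b A B : ℝ} (ha : |a| ≤ A) (hb : |b| ≤ B) : |a * b| ≤ A * B := by
  rw [abs_mul]
  exact mul_le_mul ha hb (abs_nonneg _) ((abs_nonneg _).trans ha)

lemma add_add_sq_le (u v w : ℝ) : (u + v + w) ^ 2 ≤ 3 * (u ^ 2 + v ^ 2 + w ^ 2) := by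
  nlinarith [sq_nonneg (u - v), sq_nonneg (u - w), sq_nonneg (v - w)]

/-- The lower order constant appearing in the derivative estimates. -/
def lowerConst (s L κ : ℝ) : ℝ :=
  (L + L / κ) ^ 2 / (2 * κ) + 2 * L / (-s) + L / κ

lemma lowerConst_nonneg {s L κ : ℝ} (hs : s < 0) (hL : 0 ≤ L) (hκ : 0 < κ) :
    0 ≤ lowerConst s L κ := by
  have : 0 < -s := neg_pos.2 hs
  unfold lowerConst
  positivity

/-- Pointwise dissipation estimate: the weight `q` coming from the monotonicity of the profile
absorbs the linear coupling `β`. -/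
lemma dissipation_le {s κ L p1 p2 V Φ Ψ N P β R A : ℝ} (hs : s < 0) (hκ : 0 < κ) (hL : 0 ≤ L)
    (hp1 : p1 ≤ -κ) (hp2 : 0 ≤ p2) (hV : V < 0)
    (hN : κ * Φ ^ 2 - L * (A * |Φ|) ≤ Φ * N)
    (hX : P - p1 * Φ = β + R) (hβ : β ^ 2 ≤ L * (p2 * -V) * A ^ 2)
    (hR : |Ψ * R| ≤ L * (A * |Φ| + A ^ 2)) :
    -(s * (p2 * V / p1 ^ 2) / 2 * Ψ ^ 2) - Φ * N - Ψ * (Φ + -p1⁻¹ * P)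
      ≤ -(κ / 2) * Φ ^ 2 + lowerConst s L κ * A ^ 2 := by
  have hp0 : p1 < 0 := by linarith
  have hp0' : p1 ≠ 0 := hp0.ne
  have hs' : 0 < -s := neg_pos.2 hs
  set q := s * (p2 * V / p1 ^ 2) / 2 with hq
  have hq' : q = (-s) * (p2 * -V / p1 ^ 2) / 2 := by rw [hq]; ring
  have hq0 : 0 ≤ q := by
    have : 0 < -V := neg_pos.2 hV
    rw [hq']; positivity
  have hw : |p1⁻¹| ≤ κ⁻¹ := by
    rw [abs_inv, abs_of_neg hp0]
    exact inv_anti₀ hκ (by linarith)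
  have e1 : Φ + -p1⁻¹ * P = -p1⁻¹ * (β + R) := by
    rw [← hX]; field_simp; ring
  set c := 2 * L / (-s) with hc
  have hc0 : 0 ≤ c := by positivity
  have hwβ : (p1⁻¹ * β) ^ 2 ≤ c * q * A ^ 2 := by
    have : c * q * A ^ 2 = (p1⁻¹) ^ 2 * (L * (p2 * -V) * A ^ 2) := by
      rw [hc, hq']; field_simp [hs.ne]
    rw [this, mul_pow]
    gcongr
  have h1 : p1⁻¹ * β * Ψ ≤ q * Ψ ^ 2 + c * A ^ 2 := by
    refine (abs_le_of_sq_le_sq' ?_ (by positivity)).2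
    have : (p1⁻¹ * β * Ψ) ^ 2 ≤ c * q * A ^ 2 * Ψ ^ 2 := by
      rw [mul_pow]; gcongr
    have h4 : 0 ≤ (q * Ψ ^ 2) * (c * A ^ 2) := by positivity
    nlinarith [sq_nonneg (q * Ψ ^ 2 - c * A ^ 2)]
  have h2 : p1⁻¹ * (Ψ * R) ≤ κ⁻¹ * (L * (A * |Φ| + A ^ 2)) :=
    (le_abs_self _).trans (abs_mul_le_of_le hw hR)
  have h3 : (L + L / κ) * (A * |Φ|) ≤ κ / 2 * Φ ^ 2 + (L + L / κ) ^ 2 / (2 * κ) * A ^ 2 := by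
    have h := sq_nonneg (κ * |Φ| - (L + L / κ) * A)
    have e : κ / 2 * Φ ^ 2 + (L + L / κ) ^ 2 / (2 * κ) * A ^ 2 - (L + L / κ) * (A * |Φ|)
        = (κ * |Φ| - (L + L / κ) * A) ^ 2 / (2 * κ) := by
      rw [← sq_abs Φ]; field_simp; ring
    have : 0 ≤ (κ * |Φ| - (L + L / κ) * A) ^ 2 / (2 * κ) := by positivity
    linarith
  have e2 : κ⁻¹ * (L * (A * |Φ| + A ^ 2)) = L / κ * (A * |Φ|) + L / κ * A ^ 2 := by
    field_simp
  rw [e2] at h2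
  rw [e1]
  unfold lowerConst
  rw [← hc]
  linarith

lemma dissipation_zero_le {s κ K p1 p2 V Φ Ψ N P : ℝ} (hs : s < 0) (hκ : 0 < κ) (hK : 0 < K)
    (hp1 : p1 ≤ -κ) (hp2 : 0 ≤ p2) (hV : V < 0) (hN : κ * Φ ^ 2 ≤ Φ * N)
    (hX : |P - p1 * Φ| ≤ K * Φ ^ 2) (hΨ : |Ψ| ≤ κ ^ 2 / (2 * K)) :
    -(s * (p2 * V / p1 ^ 2) / 2 * Ψ ^ 2) - Φ * N - Ψ * (Φ + -p1⁻¹ * P) ≤ -(κ / 2) * Φ ^ 2 := by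
  have hp0 : p1 < 0 := by linarith
  have hp0' : p1 ≠ 0 := hp0.ne
  have hw : |p1⁻¹| ≤ κ⁻¹ := by
    rw [abs_inv, abs_of_neg hp0]
    exact inv_anti₀ hκ (by linarith)
  have hq0 : 0 ≤ s * (p2 * V / p1 ^ 2) / 2 * Ψ ^ 2 := by
    have : s * (p2 * V / p1 ^ 2) / 2 * Ψ ^ 2 = (-s) * (p2 * -V / p1 ^ 2) / 2 * Ψ ^ 2 := by ring
    have : 0 < -V := neg_pos.2 hV
    have : 0 < -s := neg_pos.2 hs
    rw [‹s * (p2 * V / p1 ^ 2) / 2 * Ψ ^ 2 = _›]; positivity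
  have e1 : Ψ * (Φ + -p1⁻¹ * P) = -(p1⁻¹ * Ψ * (P - p1 * Φ)) := by
    field_simp; ring
  have h := (le_abs_self _).trans (abs_mul_le_of_le (abs_mul_le_of_le hw hΨ) hX)
  have e2 : κ⁻¹ * (κ ^ 2 / (2 * K)) * (K * Φ ^ 2) = κ / 2 * Φ ^ 2 := by field_simp
  rw [e1]
  linarith

lemma dissipation_one_le {s κ K p1 p2 V Φ Ψ x G1 G1v p1v : ℝ} (hs : s < 0) (hκ : 0 < κ)
    (hK : 1 ≤ K) (hp1 : p1 ≤ -κ) (hp2 : 0 ≤ p2) (hp2K : p2 ≤ K) (hV : V < 0) (hVK : |V| ≤ K)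
    (hG1 : κ ≤ G1v) (hG1l : |G1v - G1| ≤ K * |x|) (hp1l : |p1v - p1| ≤ K * |x|)
    (hp1t : |p1v - p1 - p2 * x| ≤ K * x ^ 2) (hΨ : |Ψ| ≤ 1) :
    -(s * (p2 * V / p1 ^ 2) / 2 * Ψ ^ 2) - Φ * (G1v * (V + Φ) - G1 * V)
        - Ψ * (Φ + -p1⁻¹ * (p1v * (V + Φ) - p1 * V))
      ≤ -(κ / 2) * Φ ^ 2 + lowerConst s (18 * K ^ 4) κ * x ^ 2 := by
  have hK2 : K ^ 2 ≤ 18 * K ^ 4 := by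
    have := pow_le_pow_right₀ hK (show 2 ≤ 4 by norm_num)
    have : 0 ≤ K ^ 4 := by positivity
    linarith
  have hK1 : K ≤ K ^ 2 := by nlinarith
  rw [← sq_abs x]
  refine dissipation_le (β := p2 * V * x)
    (R := (p1v - p1) * Φ + (p1v - p1 - p2 * x) * V) hs hκ (by positivity)
    hp1 hp2 hV ?_ (by ring) ?_ ?_
  · have h1 := (abs_le.1 (abs_mul_le_of_le (abs_mul_le_of_le hG1l hVK) (le_refl |Φ|))).1
    have h2 : κ * Φ ^ 2 ≤ G1v * Φ ^ 2 := by gcongr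
    have h3 : K ^ 2 * (|x| * |Φ|) ≤ 18 * K ^ 4 * (|x| * |Φ|) := by gcongr
    linarith
  · have hV' : -V ≤ K := by rwa [abs_of_neg hV] at hVK
    have h0 : 0 ≤ p2 * -V := mul_nonneg hp2 (by linarith)
    have h1 : p2 * -V ≤ K ^ 2 := by nlinarith
    rw [sq_abs]
    calc (p2 * V * x) ^ 2 = (p2 * -V) * (p2 * -V) * x ^ 2 := by ring
      _ ≤ 18 * K ^ 4 * (p2 * -V) * x ^ 2 := by
        have := h1.trans hK2
        gcongr ?_ * _ * _
  · have h1 := abs_mul_le_of_le hp1l (le_refl |Φ|)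
    have h2 := abs_mul_le_of_le hp1t hVK
    have h3 := abs_mul_le_of_le hΨ ((abs_add_le _ _).trans (add_le_add h1 h2))
    refine h3.trans ?_
    have h4 : K * (|x| * |Φ|) ≤ 18 * K ^ 4 * (|x| * |Φ|) := by
      gcongr
      linarith
    have h5 : K ^ 2 * |x| ^ 2 ≤ 18 * K ^ 4 * |x| ^ 2 := by gcongr
    rw [← sq_abs x]
    linarith

lemma dissipation_two_le {s κ K p1 p2 p3 V V2 Φ Ψ x y G1 G1v G2 G2v p1v p2v : ℝ}
    (hs : s < 0) (hκ : 0 < κ)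
    (hK : 1 ≤ K) (hp1 : p1 ≤ -κ) (hp2 : 0 ≤ p2) (hp2K : p2 ≤ K) (hp3 : p3 ^ 2 ≤ K * p2)
    (hV : V < 0) (hVK : |V| ≤ K) (hV2K : |V2| ≤ K) (hV2 : V2 ^ 2 ≤ K * -V)
    (hG1 : κ ≤ G1v) (hG1l : |G1v - G1| ≤ K * |x|) (hG2l : |G2v - G2| ≤ K * |x|)
    (hG2K : |G2v| ≤ K) (hp2vK : |p2v| ≤ K)
    (hp1l : |p1v - p1| ≤ K * |x|) (hp2l : |p2v - p2| ≤ K * |x|)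
    (hp1t : |p1v - p1 - p2 * x| ≤ K * x ^ 2) (hp2t : |p2v - p2 - p3 * x| ≤ K * x ^ 2)
    (hy : |y| ≤ 1) (hΨ : |Ψ| ≤ 1) :
    -(s * (p2 * V / p1 ^ 2) / 2 * Ψ ^ 2)
        - Φ * (G1v * (V2 + Φ) + G2v * (V + y) ^ 2 - G2 * V ^ 2 - G1 * V2)
        - Ψ * (Φ + -p1⁻¹ * (p1v * (V2 + Φ) + p2v * (V + y) ^ 2 - p2 * V ^ 2 - p1 * V2))
      ≤ -(κ / 2) * Φ ^ 2 + lowerConst s (18 * K ^ 4) κ * (|x| + |y|) ^ 2 := by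
  have hK0 : 0 ≤ K := by linarith
  have hK14 : K ≤ K ^ 4 := le_self_pow₀ hK (by norm_num)
  have hK24 : K ^ 2 ≤ K ^ 4 := pow_le_pow_right₀ hK (by norm_num)
  have hK34 : K ^ 3 ≤ K ^ 4 := pow_le_pow_right₀ hK (by norm_num)
  have hx0 := abs_nonneg x
  have hy0 := abs_nonneg y
  have hVV : |V ^ 2| ≤ K ^ 2 := by rw [abs_pow]; gcongr
  have hyy : |y ^ 2| ≤ |y| := by
    rw [abs_pow]; nlinarith
  refine dissipation_le (β := p2 * V2 * x + p3 * V ^ 2 * x + 2 * p2 * V * y)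
    (R := (p1v - p1) * Φ + (p1v - p1 - p2 * x) * V2 + (p2v - p2 - p3 * x) * V ^ 2
      + 2 * ((p2v - p2) * V * y) + p2v * y ^ 2) hs hκ (by positivity)
    hp1 hp2 hV ?_ (by ring) ?_ ?_
  · have h1 := (abs_le.1 (abs_mul_le_of_le (abs_mul_le_of_le hG1l hV2K) (le_refl |Φ|))).1
    have h2 := (abs_le.1 (abs_mul_le_of_le (abs_mul_le_of_le hG2l hVV) (le_refl |Φ|))).1
    have h3 := (abs_le.1 (abs_mul_le_of_le (abs_mul_le_of_le hG2K hyy) (le_refl |Φ|))).1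
    have h4 := (abs_le.1 (abs_mul_le_of_le (abs_mul_le_of_le (abs_mul_le_of_le hG2K hVK)
      (le_refl |y|)) (le_refl |Φ|))).1
    have h5 : κ * Φ ^ 2 ≤ G1v * Φ ^ 2 := by gcongr
    have hxΦ : 0 ≤ |x| * |Φ| := by positivity
    have hyΦ : 0 ≤ |y| * |Φ| := by positivity
    have m1 : (K ^ 2 + K ^ 3) * (|x| * |Φ|) ≤ 18 * K ^ 4 * (|x| * |Φ|) := by
      gcongr; linarith
    have m2 : (K + 2 * K ^ 2) * (|y| * |Φ|) ≤ 18 * K ^ 4 * (|y| * |Φ|) := by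
      gcongr; linarith
    linarith
  · have hV' : -V ≤ K := by rwa [abs_of_neg hV] at hVK
    have hV0 : 0 ≤ -V := by linarith
    have h0 : 0 ≤ p2 * -V := mul_nonneg hp2 hV0
    have a1 : (p2 * V2 * x) ^ 2 ≤ K ^ 2 * (p2 * -V) * x ^ 2 := by
      calc (p2 * V2 * x) ^ 2 = (p2 * p2) * V2 ^ 2 * x ^ 2 := by ring
        _ ≤ (K * p2) * (K * -V) * x ^ 2 := by gcongr
        _ = K ^ 2 * (p2 * -V) * x ^ 2 := by ring
    have a2 : (p3 * V ^ 2 * x) ^ 2 ≤ K ^ 4 * (p2 * -V) * x ^ 2 := by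
      calc (p3 * V ^ 2 * x) ^ 2 = p3 ^ 2 * ((-V) ^ 3 * -V) * x ^ 2 := by ring
        _ ≤ (K * p2) * (K ^ 3 * -V) * x ^ 2 := by gcongr
        _ = K ^ 4 * (p2 * -V) * x ^ 2 := by ring
    have a3 : (2 * p2 * V * y) ^ 2 ≤ 4 * K ^ 2 * (p2 * -V) * y ^ 2 := by
      calc (2 * p2 * V * y) ^ 2 = 4 * (p2 * -V) * (p2 * -V) * y ^ 2 := by ring
        _ ≤ 4 * (K * K) * (p2 * -V) * y ^ 2 := by gcongr
        _ = _ := by ring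
    have b1 : K ^ 2 * (p2 * -V) * x ^ 2 ≤ K ^ 4 * (p2 * -V) * x ^ 2 := by gcongr
    have b3 : 4 * K ^ 2 * (p2 * -V) * y ^ 2 ≤ 4 * K ^ 4 * (p2 * -V) * y ^ 2 := by gcongr
    have hA : x ^ 2 + y ^ 2 ≤ (|x| + |y|) ^ 2 := by
      rw [add_sq, sq_abs, sq_abs]
      nlinarith [mul_nonneg hx0 hy0]
    have hc : 0 ≤ 18 * K ^ 4 * (p2 * -V) := by positivity
    have := mul_le_mul_of_nonneg_left hA hc
    have hx2 : 0 ≤ K ^ 4 * (p2 * -V) * x ^ 2 := by positivity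
    have hy2 : 0 ≤ K ^ 4 * (p2 * -V) * y ^ 2 := by positivity
    refine (add_add_sq_le _ _ _).trans ?_
    linarith
  · have h1 := abs_mul_le_of_le hp1l (le_refl |Φ|)
    have h2 := abs_mul_le_of_le hp1t hV2K
    have h3 := abs_mul_le_of_le hp2t hVV
    have h4 := abs_mul_le_of_le (show |(2 : ℝ)| ≤ 2 by simp)
      (abs_mul_le_of_le (abs_mul_le_of_le hp2l hVK) (le_refl |y|))
    have h5 := abs_mul_le_of_le hp2vK (abs_pow y 2).le
    have h6 := abs_mul_le_of_le hΨ ((abs_add_le _ _).trans (add_le_add ((abs_add_le _ _).trans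
      (add_le_add ((abs_add_le _ _).trans (add_le_add ((abs_add_le _ _).trans
        (add_le_add h1 h2)) h3)) h4)) h5))
    refine h6.trans ?_
    rw [← sq_abs x]
    have m1 : K * (|x| * |Φ|) ≤ 18 * K ^ 4 * (|x| * |Φ|) := by
      gcongr; linarith
    have m2 : (K ^ 2 + K ^ 3) * |x| ^ 2 ≤ 18 * K ^ 4 * |x| ^ 2 := by
      gcongr; linarith
    have m3 : 2 * K ^ 2 * (|x| * |y|) ≤ 36 * K ^ 4 * (|x| * |y|) := by
      gcongr; linarith
    have m4 : K * |y| ^ 2 ≤ 18 * K ^ 4 * |y| ^ 2 := by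
      gcongr; linarith
    have m5 : 0 ≤ 18 * K ^ 4 * (|y| * |Φ|) := by positivity
    linarith

/-- The increment `h(v) - h(ṽ)` with `v = ṽ + Φ_ξ`, followed by its first two `ξ`-derivatives. -/
def increment (h tv φ : ℝ → ℝ) : ℕ → ℝ → ℝ
  | 0, ξ => h (tv ξ + iteratedDeriv 1 φ ξ) - h (tv ξ)
  | 1, ξ => deriv h (tv ξ + iteratedDeriv 1 φ ξ) * (deriv tv ξ + iteratedDeriv 2 φ ξ)
      - deriv h (tv ξ) * deriv tv ξ
  | _, ξ => deriv h (tv ξ + iteratedDeriv 1 φ ξ) * (deriv (deriv tv) ξ + iteratedDeriv 3 φ ξ)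
      + deriv (deriv h) (tv ξ + iteratedDeriv 1 φ ξ) * (deriv tv ξ + iteratedDeriv 2 φ ξ) ^ 2
      - deriv (deriv h) (tv ξ) * deriv tv ξ ^ 2 - deriv h (tv ξ) * deriv (deriv tv) ξ

lemma hasDerivAt_iteratedDeriv {φ : ℝ → ℝ} (hφ : ContDiff ℝ 4 φ) {j : ℕ} (hj : j ≤ 3) (ξ : ℝ) :
    HasDerivAt (iteratedDeriv j φ) (iteratedDeriv (j + 1) φ ξ) ξ := by
  rw [iteratedDeriv_succ]
  exact ((hφ.differentiable_iteratedDeriv j (by norm_cast; omega)) ξ).hasDerivAt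

lemma hasDerivAt_increment_zero {h tv φ : ℝ → ℝ} (hh : ContDiffOn ℝ (⊤ : ℕ∞) h (Ioi 0))
    (htv : ContDiff ℝ (⊤ : ℕ∞) tv) (hφ : ContDiff ℝ 4 φ) {ξ : ℝ} (h0 : 0 < tv ξ)
    (h1 : 0 < tv ξ + iteratedDeriv 1 φ ξ) :
    HasDerivAt (increment h tv φ 0) (increment h tv φ 1 ξ) ξ := by
  have hd : HasDerivAt tv (deriv tv ξ) ξ := (htv.differentiable (by simp) ξ).hasDerivAt
  exact ((hasDerivAt_iterate_deriv hh 0 h1).comp ξ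
    (hd.add (hasDerivAt_iteratedDeriv hφ (by norm_num) ξ))).sub
    ((hasDerivAt_iterate_deriv hh 0 h0).comp ξ hd)

lemma hasDerivAt_increment_one {h tv φ : ℝ → ℝ} (hh : ContDiffOn ℝ (⊤ : ℕ∞) h (Ioi 0))
    (htv : ContDiff ℝ (⊤ : ℕ∞) tv) (hφ : ContDiff ℝ 4 φ) {ξ : ℝ} (h0 : 0 < tv ξ)
    (h1 : 0 < tv ξ + iteratedDeriv 1 φ ξ) :
    HasDerivAt (increment h tv φ 1) (increment h tv φ 2 ξ) ξ := by
  have hd : HasDerivAt tv (deriv tv ξ) ξ := (htv.differentiable (by simp) ξ).hasDerivAt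
  have hd2 : HasDerivAt (deriv tv) (deriv (deriv tv) ξ) ξ :=
    (((contDiff_infty_iff_deriv.1 htv).2).differentiable (by simp) ξ).hasDerivAt
  have hv := hd.add (hasDerivAt_iteratedDeriv hφ (j := 1) (by norm_num) ξ)
  have hA := ((hasDerivAt_iterate_deriv hh 1 h1).comp ξ hv).mul
    (hd2.add (hasDerivAt_iteratedDeriv hφ (j := 2) (by norm_num) ξ))
  have hB := ((hasDerivAt_iterate_deriv hh 1 h0).comp ξ hd).mul hd2
  refine (hA.sub hB).congr_deriv ?_
  simp [increment]
  ring

/-- The time derivative of `∂_ξ^j F`. -/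
def timeDeriv (F : ℝ → ℝ → ℝ) (j : ℕ) (t ξ : ℝ) : ℝ :=
  deriv (fun τ => iteratedDeriv j (F τ) ξ) t

namespace IsClassicalSolution

variable {p g tv : ℝ → ℝ} {s T : ℝ} {Φ Ψ : ℝ → ℝ → ℝ}

lemma hasDerivAt_timeDeriv_left (sol : IsClassicalSolution p g tv s T Φ Ψ) {j : ℕ} (hj : j ≤ 2)
    {t : ℝ} (ht : t ∈ Ioo 0 T) (ξ : ℝ) :
    HasDerivAt (timeDeriv Φ j t) (timeDeriv Φ (j + 1) t ξ) ξ :=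
  hasDerivAt_mixed (fun t ht => hasDerivAt_iteratedDeriv (sol.regΦ t ht) (by omega))
    (fun t ht => (sol.regΦ t ht).continuous_iteratedDeriv (j + 1) (by norm_cast; omega))
    (fun t ht ξ => (sol.tdiffΦ j (by omega) t ht ξ).hasDerivAt)
    (fun t ht ξ => (sol.tdiffΦ (j + 1) (by omega) t ht ξ).hasDerivAt)
    (sol.mixContΦ (j + 1) (by omega)) ht ξ

lemma hasDerivAt_timeDeriv_right (sol : IsClassicalSolution p g tv s T Φ Ψ) {j : ℕ} (hj : j ≤ 2)
    {t : ℝ} (ht : t ∈ Ioo 0 T) (ξ : ℝ) :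
    HasDerivAt (timeDeriv Ψ j t) (timeDeriv Ψ (j + 1) t ξ) ξ :=
  hasDerivAt_mixed (fun t ht => hasDerivAt_iteratedDeriv (sol.regΨ t ht) (by omega))
    (fun t ht => (sol.regΨ t ht).continuous_iteratedDeriv (j + 1) (by norm_cast; omega))
    (fun t ht ξ => (sol.tdiffΨ j (by omega) t ht ξ).hasDerivAt)
    (fun t ht ξ => (sol.tdiffΨ (j + 1) (by omega) t ht ξ).hasDerivAt)
    (sol.mixContΨ (j + 1) (by omega)) ht ξ

/-- The first equation in divergence form, differentiated up to two times. -/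
lemma hasDerivAt_increment (sol : IsClassicalSolution p g tv s T Φ Ψ)
    (hg : ContDiffOn ℝ (⊤ : ℕ∞) g (Ioi 0)) (htv : ContDiff ℝ (⊤ : ℕ∞) tv)
    (hpos : ∀ ξ, 0 < tv ξ)
    (hv : ∀ t ∈ Icc 0 T, ∀ ξ, 0 < tv ξ + iteratedDeriv 1 (Φ t) ξ) {j : ℕ} (hj : j ≤ 2)
    {t : ℝ} (ht : t ∈ Ioo 0 T) (ξ : ℝ) :
    HasDerivAt (increment g tv (Φ t) j)
      (timeDeriv Φ j t ξ - s * iteratedDeriv (j + 1) (Φ t) ξ - iteratedDeriv (j + 1) (Ψ t) ξ)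
      ξ := by
  have htc := Ioo_subset_Icc_self ht
  have hdΦ := fun j hj ξ => hasDerivAt_iteratedDeriv (sol.regΦ t htc) (j := j) hj ξ
  have hdΨ := fun j hj ξ => hasDerivAt_iteratedDeriv (sol.regΨ t htc) (j := j) hj ξ
  have h0 : ∀ ξ, increment g tv (Φ t) 1 ξ = timeDeriv Φ 0 t ξ - s * iteratedDeriv 1 (Φ t) ξ
      - iteratedDeriv 1 (Ψ t) ξ := by
    intro ξ
    have := sol.eq1 t htc ξ
    simp only [Gterm, ← iteratedDeriv_one (f := Φ t), ← iteratedDeriv_one (f := Ψ t)] at this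
    simp only [timeDeriv, iteratedDeriv_zero, increment]
    linarith
  have hstep : ∀ j ≤ 2, HasDerivAt (fun ξ => timeDeriv Φ j t ξ
      - s * iteratedDeriv (j + 1) (Φ t) ξ - iteratedDeriv (j + 1) (Ψ t) ξ)
      (timeDeriv Φ (j + 1) t ξ - s * iteratedDeriv (j + 2) (Φ t) ξ
        - iteratedDeriv (j + 2) (Ψ t) ξ) ξ := fun j hj =>
    ((sol.hasDerivAt_timeDeriv_left hj ht ξ).fun_sub
      ((hdΦ (j + 1) (by omega) ξ).const_mul s)).fun_sub (hdΨ (j + 1) (by omega) ξ)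
  have h1 : ∀ ξ, increment g tv (Φ t) 2 ξ = timeDeriv Φ 1 t ξ - s * iteratedDeriv 2 (Φ t) ξ
      - iteratedDeriv 2 (Ψ t) ξ := by
    intro ξ
    have h := hasDerivAt_increment_one hg htv (sol.regΦ t htc) (hpos ξ) (hv t htc ξ)
    rw [funext h0] at h
    exact h.unique (((sol.hasDerivAt_timeDeriv_left (j := 0) (by norm_num) ht ξ).fun_sub
      ((hdΦ 1 (by norm_num) ξ).const_mul s)).fun_sub (hdΨ 1 (by norm_num) ξ))
  interval_cases j
  · rw [← h0 ξ]
    exact hasDerivAt_increment_zero hg htv (sol.regΦ t htc) (hpos ξ) (hv t htc ξ)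
  · rw [← h1 ξ]
    exact hasDerivAt_increment_one hg htv (sol.regΦ t htc) (hpos ξ) (hv t htc ξ)
  · rw [funext h1]
    exact hstep 1 (by norm_num)

/-- The second equation, differentiated up to two times. -/
lemma timeDeriv_right_eq (sol : IsClassicalSolution p g tv s T Φ Ψ)
    (hp : ContDiffOn ℝ (⊤ : ℕ∞) p (Ioi 0)) (htv : ContDiff ℝ (⊤ : ℕ∞) tv)
    (hpos : ∀ ξ, 0 < tv ξ)
    (hv : ∀ t ∈ Icc 0 T, ∀ ξ, 0 < tv ξ + iteratedDeriv 1 (Φ t) ξ) {j : ℕ} (hj : j ≤ 2)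
    {t : ℝ} (ht : t ∈ Ioo 0 T) (ξ : ℝ) :
    timeDeriv Ψ j t ξ = s * iteratedDeriv (j + 1) (Ψ t) ξ - increment p tv (Φ t) j ξ := by
  have htc := Ioo_subset_Icc_self ht
  have hdΨ := fun j hj ξ => hasDerivAt_iteratedDeriv (sol.regΨ t htc) (j := j) hj ξ
  have h0 : ∀ ξ, timeDeriv Ψ 0 t ξ = s * iteratedDeriv 1 (Ψ t) ξ
      - increment p tv (Φ t) 0 ξ := by
    intro ξ
    have := sol.eq2 t htc ξ
    simp only [prel, ← iteratedDeriv_one (f := Φ t), ← iteratedDeriv_one (f := Ψ t)] at this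
    simp only [timeDeriv, iteratedDeriv_zero, increment]
    linarith
  have h1 : ∀ ξ, timeDeriv Ψ 1 t ξ = s * iteratedDeriv 2 (Ψ t) ξ
      - increment p tv (Φ t) 1 ξ := by
    intro ξ
    have h := sol.hasDerivAt_timeDeriv_right (j := 0) (by norm_num) ht ξ
    rw [funext h0] at h
    exact h.unique (((hdΨ 1 (by norm_num) ξ).const_mul s).fun_sub
      (hasDerivAt_increment_zero hp htv (sol.regΦ t htc) (hpos ξ) (hv t htc ξ)))
  have h2 : ∀ ξ, timeDeriv Ψ 2 t ξ = s * iteratedDeriv 3 (Ψ t) ξ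
      - increment p tv (Φ t) 2 ξ := by
    intro ξ
    have h := sol.hasDerivAt_timeDeriv_right (j := 1) (by norm_num) ht ξ
    rw [funext h1] at h
    exact h.unique (((hdΨ 2 (by norm_num) ξ).const_mul s).fun_sub
      (hasDerivAt_increment_one hp htv (sol.regΦ t htc) (hpos ξ) (hv t htc ξ)))
  interval_cases j
  exacts [h0 ξ, h1 ξ, h2 ξ]

end IsClassicalSolution

/-- The weight `-1/p'(ṽ)` of the energy. -/
def energyWeight (p tv : ℝ → ℝ) (ξ : ℝ) : ℝ := -(deriv p (tv ξ))⁻¹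

/-- The weighted energy density of order `j`. -/
def energyDensity (p tv : ℝ → ℝ) (Φ Ψ : ℝ → ℝ → ℝ) (j : ℕ) (t ξ : ℝ) : ℝ :=
  (iteratedDeriv j (Φ t) ξ ^ 2 + energyWeight p tv ξ * iteratedDeriv j (Ψ t) ξ ^ 2) / 2

/-- The time derivative of the energy density of order `j`. -/
def energyRate (p tv : ℝ → ℝ) (Φ Ψ : ℝ → ℝ → ℝ) (j : ℕ) (t ξ : ℝ) : ℝ :=
  iteratedDeriv j (Φ t) ξ * timeDeriv Φ j t ξ
    + energyWeight p tv ξ * (iteratedDeriv j (Ψ t) ξ * timeDeriv Ψ j t ξ)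

/-- The energy flux of order `j`. -/
def energyFlux (p g tv : ℝ → ℝ) (s : ℝ) (Φ Ψ : ℝ → ℝ → ℝ) (j : ℕ) (t ξ : ℝ) : ℝ :=
  s * ((iteratedDeriv j (Φ t) ξ ^ 2 + energyWeight p tv ξ * iteratedDeriv j (Ψ t) ξ ^ 2) / 2)
    + iteratedDeriv j (Φ t) ξ * iteratedDeriv j (Ψ t) ξ
    + iteratedDeriv j (Φ t) ξ * increment g tv (Φ t) j ξ

/-- The energy production of order `j`. -/
def energyProduction (p g tv : ℝ → ℝ) (s : ℝ) (Φ Ψ : ℝ → ℝ → ℝ) (j : ℕ) (t ξ : ℝ) : ℝ :=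
  -(s * (deriv (deriv p) (tv ξ) * deriv tv ξ / deriv p (tv ξ) ^ 2) / 2
      * iteratedDeriv j (Ψ t) ξ ^ 2)
    - iteratedDeriv (j + 1) (Φ t) ξ * increment g tv (Φ t) j ξ
    - iteratedDeriv j (Ψ t) ξ * (iteratedDeriv (j + 1) (Φ t) ξ
      + -(deriv p (tv ξ))⁻¹ * increment p tv (Φ t) j ξ)

lemma hasDerivAt_energyWeight {p tv : ℝ → ℝ} (hp : ContDiffOn ℝ (⊤ : ℕ∞) p (Ioi 0))
    (htv : ContDiff ℝ (⊤ : ℕ∞) tv) {ξ : ℝ} (hpos : 0 < tv ξ) (hp0 : deriv p (tv ξ) ≠ 0) :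
    HasDerivAt (energyWeight p tv)
      (deriv (deriv p) (tv ξ) * deriv tv ξ / deriv p (tv ξ) ^ 2) ξ := by
  have hd : HasDerivAt tv (deriv tv ξ) ξ := (htv.differentiable (by simp) ξ).hasDerivAt
  refine ((((hasDerivAt_iterate_deriv hp 1 hpos).comp ξ hd).inv hp0).neg).congr_deriv ?_
  simp [neg_div]

namespace IsClassicalSolution

variable {p g tv : ℝ → ℝ} {s T : ℝ} {Φ Ψ : ℝ → ℝ → ℝ}

lemma hasDerivAt_energyDensity (sol : IsClassicalSolution p g tv s T Φ Ψ) {j : ℕ} (hj : j ≤ 3)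
    {t : ℝ} (ht : t ∈ Icc 0 T) (ξ : ℝ) :
    HasDerivAt (fun τ => energyDensity p tv Φ Ψ j τ ξ) (energyRate p tv Φ Ψ j t ξ) t := by
  have h1 := (sol.tdiffΦ j hj t ht ξ).hasDerivAt.fun_pow 2
  have h2 := ((sol.tdiffΨ j hj t ht ξ).hasDerivAt.fun_pow 2).const_mul (energyWeight p tv ξ)
  refine ((h1.fun_add h2).div_const 2).congr_deriv ?_
  simp [energyRate, timeDeriv]
  ring

lemma continuousOn_energyRate (sol : IsClassicalSolution p g tv s T Φ Ψ) {j : ℕ} (hj : j ≤ 3)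
    (hw : Continuous (energyWeight p tv)) :
    ContinuousOn (fun q : ℝ × ℝ => energyRate p tv Φ Ψ j q.1 q.2)
      (Icc (0 : ℝ) T ×ˢ (univ : Set ℝ)) :=
  ((sol.spContΦ j (by omega)).mul (sol.mixContΦ j hj)).add
    ((hw.comp continuous_snd).continuousOn.mul
      ((sol.spContΨ j (by omega)).mul (sol.mixContΨ j hj)))

/-- The local energy balance of order `j`. -/
lemma hasDerivAt_energyFlux (sol : IsClassicalSolution p g tv s T Φ Ψ)
    (hp : ContDiffOn ℝ (⊤ : ℕ∞) p (Ioi 0)) (hg : ContDiffOn ℝ (⊤ : ℕ∞) g (Ioi 0))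
    (htv : ContDiff ℝ (⊤ : ℕ∞) tv) (hpos : ∀ ξ, 0 < tv ξ) (hp0 : ∀ ξ, deriv p (tv ξ) ≠ 0)
    (hv : ∀ t ∈ Icc 0 T, ∀ ξ, 0 < tv ξ + iteratedDeriv 1 (Φ t) ξ) {j : ℕ} (hj : j ≤ 2)
    {t : ℝ} (ht : t ∈ Ioo 0 T) (ξ : ℝ) :
    HasDerivAt (energyFlux p g tv s Φ Ψ j t)
      (energyRate p tv Φ Ψ j t ξ - energyProduction p g tv s Φ Ψ j t ξ) ξ := by
  have htc := Ioo_subset_Icc_self ht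
  have hΦ := hasDerivAt_iteratedDeriv (sol.regΦ t htc) (j := j) (by omega) ξ
  have hΨ := hasDerivAt_iteratedDeriv (sol.regΨ t htc) (j := j) (by omega) ξ
  have hw := hasDerivAt_energyWeight hp htv (hpos ξ) (hp0 ξ)
  have hN := sol.hasDerivAt_increment hg htv hpos hv hj ht ξ
  have h1 := (((hΦ.fun_pow 2).fun_add (hw.fun_mul (hΨ.fun_pow 2))).div_const 2).const_mul s
  refine ((h1.fun_add (hΦ.fun_mul hΨ)).fun_add (hΦ.fun_mul hN)).congr_deriv ?_
  rw [energyRate, sol.timeDeriv_right_eq hp htv hpos hv hj ht ξ, energyProduction, energyWeight]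
  push_cast
  ring

end IsClassicalSolution

lemma hkSq_nonneg (k : ℕ) (w : ℝ → ℝ) : 0 ≤ HkSq k w :=
  Finset.sum_nonneg fun _ _ => integral_nonneg fun _ => sq_nonneg _

lemma sq_iteratedDeriv_le_hkSq {φ : ℝ → ℝ} (hφ : ContDiff ℝ 4 φ)
    (hi : ∀ j ≤ 4, Integrable fun ξ => iteratedDeriv j φ ξ ^ 2)
    (hdecay : ∀ j ≤ 3, ∀ ε > (0 : ℝ), ∃ R : ℝ, ∀ ξ, R ≤ |ξ| → |iteratedDeriv j φ ξ| < ε)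
    {j : ℕ} (hj : j ≤ 2) (ξ : ℝ) : iteratedDeriv j φ ξ ^ 2 ≤ HkSq 3 φ := by
  have h := sq_le_integral_sq_add (hasDerivAt_iteratedDeriv hφ (j := j) (by omega))
    (hφ.continuous_iteratedDeriv (j + 1) (by norm_cast; omega)) (hi j (by omega))
    (hi (j + 1) (by omega)) (hdecay j (by omega)) ξ
  have hn : ∀ i, 0 ≤ L2sq (iteratedDeriv i φ) := fun i => integral_nonneg fun _ => sq_nonneg _
  refine h.trans ?_
  change L2sq (iteratedDeriv j φ) + L2sq (iteratedDeriv (j + 1) φ) ≤ _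
  simp only [HkSq, Finset.sum_range_succ, Finset.sum_range_zero]
  interval_cases j <;> linarith [hn 0, hn 1, hn 2, hn 3]

namespace CoefficientBounds

variable {p g tv : ℝ → ℝ} {s ρ K κ : ℝ} {Φ Ψ : ℝ → ℝ → ℝ} {t ξ : ℝ}

lemma energyWeight_mem (H : CoefficientBounds p g tv ρ K κ) (ξ : ℝ) :
    energyWeight p tv ξ ∈ Icc K⁻¹ κ⁻¹ := by
  have h1 := H.dp_le ξ
  have h2 : |deriv p (tv ξ)| ≤ K := by
    simpa using H.bounds_p.bdd 1 (by norm_num) ξ 0 (by simpa using H.ρ_pos.le)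
  have hκ := H.κ_pos
  rw [energyWeight, ← inv_neg]
  exact ⟨inv_anti₀ (by linarith) ((neg_le_abs _).trans h2), inv_anti₀ hκ (by linarith)⟩

lemma energyProduction_zero_le (H : CoefficientBounds p g tv ρ K κ) (hs : s < 0)
    (h1 : |iteratedDeriv 1 (Φ t) ξ| ≤ ρ)
    (hΨ : |iteratedDeriv 0 (Ψ t) ξ| ≤ κ ^ 2 / (2 * K)) :
    energyProduction p g tv s Φ Ψ 0 t ξ ≤ -(κ / 2) * iteratedDeriv 1 (Φ t) ξ ^ 2 :=
  dissipation_zero_le hs H.κ_pos (zero_lt_one.trans_le H.one_le) (H.dp_le ξ) (H.ddp_nonneg ξ)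
    (H.dtv_neg ξ) (H.g_mono ξ _ h1) (H.bounds_p.taylor 0 (by norm_num) ξ _ h1) hΨ

lemma deriv2_le (H : CoefficientBounds p g tv ρ K κ) (ξ : ℝ) :
    deriv (deriv p) (tv ξ) ≤ K := by
  have := H.bounds_p.bdd 2 (by norm_num) ξ 0 (by simpa using H.ρ_pos.le)
  rw [add_zero] at this
  exact (le_abs_self _).trans this

lemma energyProduction_one_le (H : CoefficientBounds p g tv ρ K κ) (hs : s < 0)
    (h1 : |iteratedDeriv 1 (Φ t) ξ| ≤ ρ) (hΨ : |iteratedDeriv 1 (Ψ t) ξ| ≤ 1) :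
    energyProduction p g tv s Φ Ψ 1 t ξ ≤ -(κ / 2) * iteratedDeriv 2 (Φ t) ξ ^ 2
      + lowerConst s (18 * K ^ 4) κ * iteratedDeriv 1 (Φ t) ξ ^ 2 :=
  dissipation_one_le hs H.κ_pos H.one_le (H.dp_le ξ) (H.ddp_nonneg ξ) (H.deriv2_le ξ)
    (H.dtv_neg ξ) (H.dtv_le ξ) (H.dg_ge ξ _ h1) (H.bounds_g.lip 1 (by norm_num) ξ _ h1)
    (H.bounds_p.lip 1 (by norm_num) ξ _ h1) (H.bounds_p.taylor 1 (by norm_num) ξ _ h1) hΨ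

lemma energyProduction_two_le (H : CoefficientBounds p g tv ρ K κ) (hs : s < 0)
    (h1 : |iteratedDeriv 1 (Φ t) ξ| ≤ ρ) (h2 : |iteratedDeriv 2 (Φ t) ξ| ≤ 1)
    (hΨ : |iteratedDeriv 2 (Ψ t) ξ| ≤ 1) :
    energyProduction p g tv s Φ Ψ 2 t ξ ≤ -(κ / 2) * iteratedDeriv 3 (Φ t) ξ ^ 2
      + lowerConst s (18 * K ^ 4) κ
        * (|iteratedDeriv 1 (Φ t) ξ| + |iteratedDeriv 2 (Φ t) ξ|) ^ 2 :=
  dissipation_two_le hs H.κ_pos H.one_le (H.dp_le ξ) (H.ddp_nonneg ξ) (H.deriv2_le ξ)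
    (H.dddp_sq ξ) (H.dtv_neg ξ) (H.dtv_le ξ) (H.ddtv_le ξ) (H.ddtv_sq ξ) (H.dg_ge ξ _ h1)
    (H.bounds_g.lip 1 (by norm_num) ξ _ h1) (H.bounds_g.lip 2 (by norm_num) ξ _ h1)
    (H.bounds_g.bdd 2 (by norm_num) ξ _ h1) (H.bounds_p.bdd 2 (by norm_num) ξ _ h1)
    (H.bounds_p.lip 1 (by norm_num) ξ _ h1) (H.bounds_p.lip 2 (by norm_num) ξ _ h1)
    (H.bounds_p.taylor 1 (by norm_num) ξ _ h1) (H.bounds_p.taylor 2 (by norm_num) ξ _ h1) h2 hΨ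

lemma abs_increment_le (H : CoefficientBounds p g tv ρ K κ) {φ : ℝ → ℝ}
    (h1 : |iteratedDeriv 1 φ ξ| ≤ ρ) (h1' : |iteratedDeriv 1 φ ξ| ≤ 1)
    (h2 : |iteratedDeriv 2 φ ξ| ≤ 1) (h3 : |iteratedDeriv 3 φ ξ| ≤ 1) {j : ℕ} (hj : j ≤ 2) :
    |increment g tv φ j ξ| ≤ 8 * K ^ 3 := by
  have hK := H.one_le
  have hK0 : 0 ≤ K := by linarith
  have hK1 : K ≤ K ^ 3 := le_self_pow₀ hK (by norm_num)
  have hK2 : K ^ 2 ≤ K ^ 3 := pow_le_pow_right₀ hK (by norm_num)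
  have h00 : |(0 : ℝ)| ≤ ρ := by simpa using H.ρ_pos.le
  have hV := H.dtv_le ξ
  have hV2 := H.ddtv_le ξ
  have a1 : |deriv g (tv ξ + iteratedDeriv 1 φ ξ)| ≤ K :=
    H.bounds_g.bdd 1 (by norm_num) ξ _ h1
  have a2 : |deriv (deriv g) (tv ξ + iteratedDeriv 1 φ ξ)| ≤ K :=
    H.bounds_g.bdd 2 (by norm_num) ξ _ h1
  have b1 : |deriv g (tv ξ)| ≤ K := by simpa using H.bounds_g.bdd 1 (by norm_num) ξ 0 h00
  have b2 : |deriv (deriv g) (tv ξ)| ≤ K := by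
    simpa using H.bounds_g.bdd 2 (by norm_num) ξ 0 h00
  have c2 : |deriv tv ξ + iteratedDeriv 2 φ ξ| ≤ 2 * K :=
    (abs_add_le _ _).trans (by linarith)
  have c3 : |deriv (deriv tv) ξ + iteratedDeriv 3 φ ξ| ≤ 2 * K :=
    (abs_add_le _ _).trans (by linarith)
  have sq_le : ∀ {x a : ℝ}, |x| ≤ a → |x ^ 2| ≤ a ^ 2 := fun h => by
    rw [abs_pow]; gcongr
  interval_cases j
  · have := H.bounds_g.lip 0 (by norm_num) ξ _ h1
    refine this.trans ?_
    nlinarith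
  · refine (abs_sub _ _).trans ?_
    have := abs_mul_le_of_le a1 c2
    have := abs_mul_le_of_le b1 hV
    linarith [pow_nonneg hK0 3]
  · have e1 := abs_mul_le_of_le a1 c3
    have e2 := abs_mul_le_of_le a2 (sq_le c2)
    have e3 := abs_mul_le_of_le b2 (sq_le hV)
    have e4 := abs_mul_le_of_le b1 hV2
    refine (abs_sub _ _).trans (le_trans (add_le_add_left ((abs_sub _ _).trans
      (add_le_add_left (abs_add_le _ _) _)) _) ?_)
    linarith

lemma abs_energyFlux_le (H : CoefficientBounds p g tv ρ K κ) {η : ℝ} (hη1 : η ≤ 1)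
    (hηρ : η ≤ ρ) (hΦ : ∀ i ≤ 3, |iteratedDeriv i (Φ t) ξ| ≤ η)
    (hΨ : ∀ i ≤ 3, |iteratedDeriv i (Ψ t) ξ| ≤ η) {j : ℕ} (hj : j ≤ 2) :
    |energyFlux p g tv s Φ Ψ j t ξ| ≤ η * (|s| * (1 + κ⁻¹) + 1 + 8 * K ^ 3) := by
  have hη0 : 0 ≤ η := (abs_nonneg _).trans (hΦ 0 (by norm_num))
  have hκ := H.κ_pos
  have hκ' : 0 < κ⁻¹ := inv_pos.2 hκ
  have hw := H.energyWeight_mem ξ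
  have hw0 : 0 ≤ energyWeight p tv ξ :=
    le_trans (inv_nonneg.2 (zero_le_one.trans H.one_le)) hw.1
  have hN := H.abs_increment_le ((hΦ 1 (by norm_num)).trans hηρ) ((hΦ 1 (by norm_num)).trans hη1)
    ((hΦ 2 (by norm_num)).trans hη1) ((hΦ 3 (by norm_num)).trans hη1) hj
  have ha := hΦ j (by omega)
  have hb := hΨ j (by omega)
  unfold energyFlux
  set a := iteratedDeriv j (Φ t) ξ
  set b := iteratedDeriv j (Ψ t) ξ
  have sq_le : ∀ {x : ℝ}, |x| ≤ η → x ^ 2 ≤ η := fun {x} h => by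
    rw [← sq_abs]; nlinarith [abs_nonneg x]
  have e1 : |(a ^ 2 + energyWeight p tv ξ * b ^ 2) / 2| ≤ η * (1 + κ⁻¹) := by
    rw [abs_of_nonneg (by positivity)]
    have h1 := mul_le_mul hw.2 (sq_le hb) (sq_nonneg _) hκ'.le
    have h2 := sq_le ha
    have h3 : 0 ≤ κ⁻¹ * η := by positivity
    linarith
  have e2 := abs_mul_le_of_le (le_refl |s|) e1
  have e3 := abs_mul_le_of_le ha (hb.trans hη1)
  have e4 := abs_mul_le_of_le ha hN
  refine (abs_add_three _ _ _).trans ?_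
  linarith

lemma continuous_energyWeight (H : CoefficientBounds p g tv ρ K κ)
    (hp : ContDiffOn ℝ (⊤ : ℕ∞) p (Ioi 0)) (htv : ContDiff ℝ (⊤ : ℕ∞) tv)
    (hpos : ∀ ξ, 0 < tv ξ) : Continuous (energyWeight p tv) :=
  continuous_iff_continuousAt.2 fun ξ => (hasDerivAt_energyWeight hp htv (hpos ξ)
    (by linarith [H.dp_le ξ, H.κ_pos] : deriv p (tv ξ) < 0).ne).continuousAt

end CoefficientBounds

namespace IsClassicalSolution

variable {p g tv : ℝ → ℝ} {s T ρ K κ : ℝ} {Φ Ψ : ℝ → ℝ → ℝ}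

lemma abs_iteratedDeriv_le (sol : IsClassicalSolution p g tv s T Φ Ψ) {t δ : ℝ}
    (ht : t ∈ Icc 0 T) (hδ : Real.sqrt (pairHkSq 3 (Φ t) (Ψ t)) ≤ δ) {j : ℕ} (hj : j ≤ 2)
    (ξ : ℝ) : |iteratedDeriv j (Φ t) ξ| ≤ δ ∧ |iteratedDeriv j (Ψ t) ξ| ≤ δ := by
  have h1 := sq_iteratedDeriv_le_hkSq (sol.regΦ t ht) (fun i hi => sol.sqIntΦ i hi t ht)
    (fun i hi ε hε => (sol.decayΦ i hi ε hε).imp fun R hR => hR t ht) hj ξ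
  have h2 := sq_iteratedDeriv_le_hkSq (sol.regΨ t ht) (fun i hi => sol.sqIntΨ i hi t ht)
    (fun i hi ε hε => (sol.decayΨ i hi ε hε).imp fun R hR => hR t ht) hj ξ
  have h3 := hkSq_nonneg 3 (Φ t)
  have h4 := hkSq_nonneg 3 (Ψ t)
  exact ⟨(Real.abs_le_sqrt (by unfold pairHkSq; linarith)).trans hδ,
    (Real.abs_le_sqrt (by unfold pairHkSq; linarith)).trans hδ⟩

lemma exists_forall_abs_lt (sol : IsClassicalSolution p g tv s T Φ Ψ) {η : ℝ} (hη : 0 < η) :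
    ∃ R : ℝ, ∀ t ∈ Icc (0 : ℝ) T, ∀ ξ, R ≤ |ξ| → ∀ j ≤ 3,
      |iteratedDeriv j (Φ t) ξ| < η ∧ |iteratedDeriv j (Ψ t) ξ| < η := by
  have h : ∀ j, ∃ R : ℝ, j ≤ 3 → ∀ t ∈ Icc (0 : ℝ) T, ∀ ξ, R ≤ |ξ| →
      |iteratedDeriv j (Φ t) ξ| < η ∧ |iteratedDeriv j (Ψ t) ξ| < η := fun j => by
    by_cases hj : j ≤ 3
    · obtain ⟨R₁, h₁⟩ := sol.decayΦ j hj η hη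
      obtain ⟨R₂, h₂⟩ := sol.decayΨ j hj η hη
      exact ⟨max R₁ R₂, fun _ t ht ξ hξ =>
        ⟨h₁ t ht ξ (le_of_max_le_left hξ), h₂ t ht ξ (le_of_max_le_right hξ)⟩⟩
    · exact ⟨0, fun h => absurd h hj⟩
  choose R hR using h
  refine ⟨∑ j ∈ Finset.range 4, |R j|, fun t ht ξ hξ j hj => hR j hj t ht ξ ?_⟩
  have := Finset.single_le_sum (f := fun j => |R j|) (fun _ _ => abs_nonneg _)
    (Finset.mem_range.2 (Nat.lt_succ_of_le hj))
  exact (le_abs_self _).trans (this.trans hξ)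

lemma energyFlux_decay (sol : IsClassicalSolution p g tv s T Φ Ψ)
    (H : CoefficientBounds p g tv ρ K κ) {ε : ℝ} (hε : 0 < ε) :
    ∃ R : ℝ, ∀ t ∈ Icc (0 : ℝ) T, ∀ ξ, R ≤ |ξ| → ∀ j ≤ 2,
      |energyFlux p g tv s Φ Ψ j t ξ| ≤ ε := by
  have hK := zero_le_one.trans H.one_le
  have hκ := H.κ_pos
  set L := |s| * (1 + κ⁻¹) + 1 + 8 * K ^ 3
  have hL : 0 < L := by positivity
  have hη : 0 < min (min 1 ρ) (ε / L) :=
    lt_min (lt_min one_pos H.ρ_pos) (by positivity)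
  obtain ⟨R, hR⟩ := sol.exists_forall_abs_lt hη
  refine ⟨R, fun t ht ξ hξ j hj => ?_⟩
  refine (H.abs_energyFlux_le ((min_le_left _ _).trans (min_le_left _ _))
    ((min_le_left _ _).trans (min_le_right _ _))
    (fun i hi => (hR t ht ξ hξ i hi).1.le) (fun i hi => (hR t ht ξ hξ i hi).2.le) hj).trans ?_
  exact (mul_le_mul_of_nonneg_right (min_le_right _ _) hL.le).trans
    (div_mul_cancel₀ ε hL.ne').le

lemma integrable_energyDensity (sol : IsClassicalSolution p g tv s T Φ Ψ)
    (H : CoefficientBounds p g tv ρ K κ) (hw : Continuous (energyWeight p tv))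
    {j : ℕ} (hj : j ≤ 3) {t : ℝ} (ht : t ∈ Icc 0 T) :
    Integrable (energyDensity p tv Φ Ψ j t) := by
  refine ((sol.sqIntΦ j (by omega) t ht).add
    ((sol.sqIntΨ j (by omega) t ht).bdd_mul (c := κ⁻¹) hw.aestronglyMeasurable
      (ae_of_all _ fun ξ => ?_))).div_const 2
  have hm := H.energyWeight_mem ξ
  rw [Real.norm_of_nonneg (le_trans (inv_nonneg.2 (zero_le_one.trans H.one_le)) hm.1)]
  exact hm.2

lemma integral_energyDensity_le (sol : IsClassicalSolution p g tv s T Φ Ψ)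
    (H : CoefficientBounds p g tv ρ K κ) (hw : Continuous (energyWeight p tv))
    {j : ℕ} (hj : j ≤ 3) {t : ℝ} (ht : t ∈ Icc 0 T) :
    ∫ ξ, energyDensity p tv Φ Ψ j t ξ
      ≤ (1 + κ⁻¹) * (L2sq (iteratedDeriv j (Φ t)) + L2sq (iteratedDeriv j (Ψ t))) := by
  have hΦ := sol.sqIntΦ j (by omega) t ht
  have hΨ := sol.sqIntΨ j (by omega) t ht
  rw [L2sq, L2sq, ← integral_add hΦ hΨ, ← integral_const_mul]
  refine integral_mono (sol.integrable_energyDensity H hw hj ht) ((hΦ.add hΨ).const_mul _)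
    fun ξ => ?_
  have hκ : 0 < κ⁻¹ := inv_pos.2 H.κ_pos
  have h1 := mul_le_mul_of_nonneg_right (H.energyWeight_mem ξ).2
    (sq_nonneg (iteratedDeriv j (Ψ t) ξ))
  have h2 : 0 ≤ κ⁻¹ * iteratedDeriv j (Ψ t) ξ ^ 2 := by positivity
  have h3 : 0 ≤ κ⁻¹ * iteratedDeriv j (Φ t) ξ ^ 2 := by positivity
  simp only [energyDensity]
  linarith [sq_nonneg (iteratedDeriv j (Ψ t) ξ), sq_nonneg (iteratedDeriv j (Φ t) ξ)]

lemma le_integral_energyDensity (sol : IsClassicalSolution p g tv s T Φ Ψ)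
    (H : CoefficientBounds p g tv ρ K κ) (hw : Continuous (energyWeight p tv))
    {j : ℕ} (hj : j ≤ 3) {t : ℝ} (ht : t ∈ Icc 0 T) :
    K⁻¹ / 2 * (L2sq (iteratedDeriv j (Φ t)) + L2sq (iteratedDeriv j (Ψ t)))
      ≤ ∫ ξ, energyDensity p tv Φ Ψ j t ξ := by
  have hΦ := sol.sqIntΦ j (by omega) t ht
  have hΨ := sol.sqIntΨ j (by omega) t ht
  rw [L2sq, L2sq, ← integral_add hΦ hΨ, ← integral_const_mul]
  refine integral_mono ((hΦ.add hΨ).const_mul _) (sol.integrable_energyDensity H hw hj ht)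
    fun ξ => ?_
  have h1 := mul_le_mul_of_nonneg_right (H.energyWeight_mem ξ).1
    (sq_nonneg (iteratedDeriv j (Ψ t) ξ))
  have h2 := mul_le_mul_of_nonneg_right (inv_le_one_of_one_le₀ H.one_le)
    (sq_nonneg (iteratedDeriv j (Φ t) ξ))
  simp only [energyDensity]
  linarith

lemma integral_energyDensity_nonneg (sol : IsClassicalSolution p g tv s T Φ Ψ)
    (H : CoefficientBounds p g tv ρ K κ) (hw : Continuous (energyWeight p tv))
    {j : ℕ} (hj : j ≤ 3) {t : ℝ} (ht : t ∈ Icc 0 T) :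
    0 ≤ ∫ ξ, energyDensity p tv Φ Ψ j t ξ := by
  refine le_trans ?_ (sol.le_integral_energyDensity H hw hj ht)
  have hK := zero_le_one.trans H.one_le
  have hn : ∀ w : ℝ → ℝ, 0 ≤ L2sq w := fun w => integral_nonneg fun _ => sq_nonneg _
  exact mul_nonneg (by positivity) (add_nonneg (hn _) (hn _))

/-- The energy inequality for the combination of the energies of order at most two. -/
lemma energy_inequality (sol : IsClassicalSolution p g tv s T Φ Ψ)
    (H : CoefficientBounds p g tv ρ K κ) (hs : s < 0)
    (hp : ContDiffOn ℝ (⊤ : ℕ∞) p (Ioi 0)) (hg : ContDiffOn ℝ (⊤ : ℕ∞) g (Ioi 0))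
    (htv : ContDiff ℝ (⊤ : ℕ∞) tv) {M A B : ℝ} (hM : M = lowerConst s (18 * K ^ 4) κ)
    (hA : A = 4 * M / κ) (hB : B = 2 * (2 * M + A * M) / κ)
    (hsmall : ∀ t ∈ Icc (0 : ℝ) T, ∀ j ≤ 2, ∀ ξ,
      |iteratedDeriv j (Φ t) ξ| ≤ min (min ρ 1) (κ ^ 2 / (2 * K)) ∧
      |iteratedDeriv j (Ψ t) ξ| ≤ min (min ρ 1) (κ ^ 2 / (2 * K)))
    {t : ℝ} (ht : t ∈ Icc 0 T) :
    (∫ ξ, (energyDensity p tv Φ Ψ 2 t ξ + A * energyDensity p tv Φ Ψ 1 t ξ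
        + B * energyDensity p tv Φ Ψ 0 t ξ))
      + ∫ τ in (0 : ℝ)..t, ∫ ξ, κ / 2 * iteratedDeriv 3 (Φ τ) ξ ^ 2
      ≤ ∫ ξ, (energyDensity p tv Φ Ψ 2 0 ξ + A * energyDensity p tv Φ Ψ 1 0 ξ
        + B * energyDensity p tv Φ Ψ 0 0 ξ) := by
  have hκ := H.κ_pos
  have hK := H.one_le
  have hM0 : 0 ≤ M := hM ▸ lowerConst_nonneg hs (by positivity) hκ
  have hA0 : 0 ≤ A := by rw [hA]; positivity
  have hB0 : 0 ≤ B := by rw [hB]; positivity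
  have hpos : ∀ ξ, 0 < tv ξ := fun ξ => by
    simpa using H.pos ξ 0 (by simpa using H.ρ_pos.le)
  have hp0 : ∀ ξ, deriv p (tv ξ) ≠ 0 := fun ξ => by
    have := H.dp_le ξ
    exact (by linarith : deriv p (tv ξ) < 0).ne
  have hw := H.continuous_energyWeight hp htv hpos
  have hρ1 : ∀ {x : ℝ}, x ≤ min (min ρ 1) (κ ^ 2 / (2 * K)) → x ≤ ρ :=
    fun h => h.trans ((min_le_left _ _).trans (min_le_left _ _))
  have hone : ∀ {x : ℝ}, x ≤ min (min ρ 1) (κ ^ 2 / (2 * K)) → x ≤ 1 :=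
    fun h => h.trans ((min_le_left _ _).trans (min_le_right _ _))
  have hv : ∀ t ∈ Icc 0 T, ∀ ξ, 0 < tv ξ + iteratedDeriv 1 (Φ t) ξ := fun t ht ξ =>
    H.pos ξ _ (hρ1 (hsmall t ht 1 (by norm_num) ξ).1)
  have hE := fun j (hj : j ≤ 2) t (ht : t ∈ Icc 0 T) ξ =>
    sol.hasDerivAt_energyDensity (j := j) (by omega) ht ξ
  have hR := fun j (hj : j ≤ 2) =>
    sol.continuousOn_energyRate (j := j) (by omega) hw
  have hI := fun j (hj : j ≤ 2) t (ht : t ∈ Icc 0 T) =>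
    sol.integrable_energyDensity H hw (j := j) (by omega) ht
  have hF := fun j (hj : j ≤ 2) t (ht : t ∈ Ioo 0 T) ξ =>
    sol.hasDerivAt_energyFlux hp hg htv hpos hp0 hv hj ht ξ
  refine integral_energy_le (T := T)
    (e := fun t ξ => energyDensity p tv Φ Ψ 2 t ξ + A * energyDensity p tv Φ Ψ 1 t ξ
        + B * energyDensity p tv Φ Ψ 0 t ξ)
    (d := fun t ξ => κ / 2 * iteratedDeriv 3 (Φ t) ξ ^ 2)
    (H := fun t ξ => energyFlux p g tv s Φ Ψ 2 t ξ + A * energyFlux p g tv s Φ Ψ 1 t ξ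
        + B * energyFlux p g tv s Φ Ψ 0 t ξ)
    (fun t ht ξ => ((hE 2 le_rfl t ht ξ).fun_add
      ((hE 1 (by norm_num) t ht ξ).const_mul A)).fun_add
      ((hE 0 (by norm_num) t ht ξ).const_mul B))
    (((hR 2 le_rfl).add (continuousOn_const.mul (hR 1 (by norm_num)))).add
      (continuousOn_const.mul (hR 0 (by norm_num))))
    (continuousOn_const.mul ((sol.spContΦ 3 (by norm_num)).pow 2))
    (fun t ξ => by positivity)
    (fun t ht => ((hI 2 le_rfl t ht).add ((hI 1 (by norm_num) t ht).const_mul A)).add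
      ((hI 0 (by norm_num) t ht).const_mul B))
    (fun t ht => (sol.sqIntΦ 3 (by norm_num) t ht).const_mul _)
    ?_
    (fun t ht ξ => ((hF 2 le_rfl t ht ξ).fun_add
      ((hF 1 (by norm_num) t ht ξ).const_mul A)).fun_add
      ((hF 0 (by norm_num) t ht ξ).const_mul B))
    ?_ ?_ ht
  · simp only [integral_const_mul]
    exact continuousOn_const.mul (sol.l2ContΦ 3 (by norm_num))
  · intro t ht ξ
    have htc := Ioo_subset_Icc_self ht
    have hsm := fun j hj => hsmall t htc j hj ξ
    have d0 := H.energyProduction_zero_le hs (hρ1 (hsm 1 (by norm_num)).1)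
      ((hsm 0 (by norm_num)).2.trans (min_le_right _ _))
    have d1 := H.energyProduction_one_le hs (hρ1 (hsm 1 (by norm_num)).1)
      (hone (hsm 1 (by norm_num)).2)
    have d2 := H.energyProduction_two_le hs (hρ1 (hsm 1 (by norm_num)).1)
      (hone (hsm 2 le_rfl).1) (hone (hsm 2 le_rfl).2)
    rw [← hM] at d1 d2
    have hsq : (|iteratedDeriv 1 (Φ t) ξ| + |iteratedDeriv 2 (Φ t) ξ|) ^ 2
        ≤ 2 * (iteratedDeriv 1 (Φ t) ξ ^ 2 + iteratedDeriv 2 (Φ t) ξ ^ 2) := by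
      simpa using add_sq_le (a := |iteratedDeriv 1 (Φ t) ξ|) (b := |iteratedDeriv 2 (Φ t) ξ|)
    have d2' := d2.trans (add_le_add_right (mul_le_mul_of_nonneg_left hsq hM0) _)
    have d1' := mul_le_mul_of_nonneg_left d1 hA0
    have d0' := mul_le_mul_of_nonneg_left d0 hB0
    have eA : A * (κ / 2) = 2 * M := by rw [hA]; field_simp; ring
    have eB : B * (κ / 2) = 2 * M + A * M := by rw [hB]; field_simp
    linear_combination d2' + d1' + d0' - iteratedDeriv 2 (Φ t) ξ ^ 2 * eA
      - iteratedDeriv 1 (Φ t) ξ ^ 2 * eB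
  · intro ε hε
    have hc : 0 < 2 * (1 + A + B) := by positivity
    obtain ⟨R, hR⟩ := sol.energyFlux_decay H (show 0 < ε / (2 * (1 + A + B)) by positivity)
    refine ⟨R, fun t ht ξ hξ => ?_⟩
    have hfl := hR t ht ξ hξ
    refine (abs_add_three _ _ _).trans_lt ?_
    rw [abs_mul, abs_mul, abs_of_nonneg hA0, abs_of_nonneg hB0]
    have h1 := mul_le_mul_of_nonneg_left (hfl 1 (by norm_num)) hA0
    have h0 := mul_le_mul_of_nonneg_left (hfl 0 (by norm_num)) hB0
    have h2 := hfl 2 le_rfl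
    have : (1 + A + B) * (ε / (2 * (1 + A + B))) = ε / 2 := by field_simp
    linarith

end IsClassicalSolution

theorem second_order_energy_estimate
    (p : ℝ → ℝ)
    (hp_smooth : ContDiffOn ℝ (⊤ : ℕ∞) p (Set.Ioi 0))
    (hpd : ∀ v ∈ Set.Ioi (0:ℝ), deriv p v < 0)
    (hpdd : ∀ v ∈ Set.Ioi (0:ℝ), 0 ≤ deriv (deriv p) v)
    (hpdd_ne : ∀ a b : ℝ, 0 < a → a < b → ∃ v ∈ Set.Ioo a b, deriv (deriv p) v ≠ 0)
    (μ : ℝ → ℝ)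
    (hmu_smooth : ContDiffOn ℝ (⊤ : ℕ∞) μ (Set.Ioi 0))
    (hmu_pos : ∀ v ∈ Set.Ioi (0:ℝ), 0 < μ v)
    (vp vm s : ℝ)
    (hvp : 0 < vp) (hvpvm : vp < vm)
    (hs : s = -Real.sqrt (-((p vp - p vm) / (vp - vm))))
    (hsneg : s < 0)
    (g : ℝ → ℝ)
    (hg : ∀ z ∈ Set.Ioi (0:ℝ), HasDerivAt g (μ z / z) z)
    (tv : ℝ → ℝ)
    (htv_smooth : ContDiff ℝ (⊤ : ℕ∞) tv)
    (htv_ode : ∀ ξ : ℝ, deriv tv ξ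
        = tv ξ / (-s * μ (tv ξ)) * (s ^ 2 * (tv ξ - vm) + p (tv ξ) - p vm))
    (htv_mem : ∀ ξ : ℝ, tv ξ ∈ Set.Ioo vp vm)
    (htv_dec : ∀ ξ : ℝ, deriv tv ξ < 0)
    (htv_bot : Filter.Tendsto tv Filter.atBot (nhds vm))
    (htv_top : Filter.Tendsto tv Filter.atTop (nhds vp))
    (htv_bdd : ∀ k : ℕ, ∃ M : ℝ, ∀ ξ : ℝ, |iteratedDeriv k tv ξ| ≤ M)
 :
    ∃ δ₀ > (0:ℝ), ∃ C > (0:ℝ), ∀ T > (0:ℝ), ∀ δ ≤ δ₀, ∀ Φ Ψ : ℝ → ℝ → ℝ,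
      IsClassicalSolution p g tv s T Φ Ψ →
      (∀ t ∈ Set.Icc (0:ℝ) T, Real.sqrt (pairHkSq 3 (Φ t) (Ψ t)) ≤ δ) →
      ∀ t ∈ Set.Icc (0:ℝ) T,
        L2sq (iteratedDeriv 2 (Φ t)) + L2sq (iteratedDeriv 2 (Ψ t))
            + (∫ τ in (0:ℝ)..t, ∫ ξ : ℝ, (iteratedDeriv 3 (Φ τ) ξ) ^ 2)
          ≤ C * pairHkSq 2 (Φ 0) (Ψ 0) := by

  obtain ⟨hg_smooth, ρ, K, κ, H⟩ := exists_coefficientBounds hp_smooth hpd hpdd hmu_smooth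
    hmu_pos hvp hg htv_smooth htv_mem htv_dec htv_bdd
  have hκ := H.κ_pos
  have hK : 0 < K := zero_lt_one.trans_le H.one_le
  have hρ := H.ρ_pos
  obtain ⟨M, hM⟩ : ∃ M, M = lowerConst s (18 * K ^ 4) κ := ⟨_, rfl⟩
  obtain ⟨A, hA⟩ : ∃ A, A = 4 * M / κ := ⟨_, rfl⟩
  obtain ⟨B, hB⟩ : ∃ B, B = 2 * (2 * M + A * M) / κ := ⟨_, rfl⟩
  have hM0 : 0 ≤ M := hM ▸ lowerConst_nonneg hsneg (by positivity) hκ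
  have hA0 : 0 ≤ A := by rw [hA]; positivity
  have hB0 : 0 ≤ B := by rw [hB]; positivity
  have hc : 0 < min (K⁻¹ / 2) (κ / 2) := by positivity
  refine ⟨min (min ρ 1) (κ ^ 2 / (2 * K)), by positivity,
    (1 + A + B) * (1 + κ⁻¹) / min (K⁻¹ / 2) (κ / 2), by positivity, ?_⟩
  intro T hT δ hδ Φ Ψ sol hsmall t ht
  have h0 : (0 : ℝ) ∈ Icc 0 T := ⟨le_rfl, hT.le⟩
  have hw := H.continuous_energyWeight hp_smooth htv_smooth fun ξ => hvp.trans (htv_mem ξ).1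
  have key := sol.energy_inequality H hsneg hp_smooth hg_smooth htv_smooth hM hA hB
    (fun t ht j hj ξ => (sol.abs_iteratedDeriv_le ht (hsmall t ht) hj ξ).imp
      (fun h => h.trans hδ) (fun h => h.trans hδ)) ht
  have hsplit : ∀ t ∈ Icc 0 T, ∫ ξ, (energyDensity p tv Φ Ψ 2 t ξ
      + A * energyDensity p tv Φ Ψ 1 t ξ + B * energyDensity p tv Φ Ψ 0 t ξ)
      = (∫ ξ, energyDensity p tv Φ Ψ 2 t ξ) + A * (∫ ξ, energyDensity p tv Φ Ψ 1 t ξ)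
        + B * ∫ ξ, energyDensity p tv Φ Ψ 0 t ξ := fun t ht => by
    have hI := fun j (hj : j ≤ 3) => sol.integrable_energyDensity H hw hj ht
    rw [integral_add ((hI 2 (by norm_num)).fun_add ((hI 1 (by norm_num)).const_mul A))
      ((hI 0 (by norm_num)).const_mul B), integral_add (hI 2 (by norm_num))
      ((hI 1 (by norm_num)).const_mul A), integral_const_mul, integral_const_mul]
  rw [hsplit t ht, hsplit 0 h0] at key
  simp only [integral_const_mul, intervalIntegral.integral_const_mul] at key
  have hn : ∀ w : ℝ → ℝ, 0 ≤ L2sq w := fun w => integral_nonneg fun _ => sq_nonneg _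
  have hD : 0 ≤ ∫ τ in (0 : ℝ)..t, ∫ ξ, iteratedDeriv 3 (Φ τ) ξ ^ 2 :=
    intervalIntegral.integral_nonneg ht.1 fun τ _ => hn _
  have l2 := sol.le_integral_energyDensity H hw (j := 2) (by norm_num) ht
  have l1 := mul_nonneg hA0 (sol.integral_energyDensity_nonneg H hw (j := 1) (by norm_num) ht)
  have l0 := mul_nonneg hB0 (sol.integral_energyDensity_nonneg H hw (j := 0) (by norm_num) ht)
  have hX : ∀ j, 0 ≤ L2sq (iteratedDeriv j (Φ 0)) + L2sq (iteratedDeriv j (Ψ 0)) :=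
    fun j => add_nonneg (hn _) (hn _)
  have hP : pairHkSq 2 (Φ 0) (Ψ 0)
      = (L2sq (iteratedDeriv 0 (Φ 0)) + L2sq (iteratedDeriv 0 (Ψ 0)))
        + (L2sq (iteratedDeriv 1 (Φ 0)) + L2sq (iteratedDeriv 1 (Ψ 0)))
        + (L2sq (iteratedDeriv 2 (Φ 0)) + L2sq (iteratedDeriv 2 (Ψ 0))) := by
    simp only [pairHkSq, HkSq, Finset.sum_range_succ, Finset.sum_range_zero]
    ring
  have hκ1 : 0 < 1 + κ⁻¹ := by positivity
  have up : ∀ j ≤ 2, ∫ ξ, energyDensity p tv Φ Ψ j 0 ξ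
      ≤ (1 + κ⁻¹) * pairHkSq 2 (Φ 0) (Ψ 0) := fun j hj => by
    refine (sol.integral_energyDensity_le H hw (j := j) (by omega) h0).trans
      (mul_le_mul_of_nonneg_left ?_ hκ1.le)
    rw [hP]
    interval_cases j <;> linarith [hX 0, hX 1, hX 2]
  have u2 := up 2 le_rfl
  have u1 := mul_le_mul_of_nonneg_left (up 1 (by norm_num)) hA0
  have u0 := mul_le_mul_of_nonneg_left (up 0 (by norm_num)) hB0
  have m1 := mul_le_mul_of_nonneg_right (min_le_left (K⁻¹ / 2) (κ / 2))
    (add_nonneg (hn (iteratedDeriv 2 (Φ t))) (hn (iteratedDeriv 2 (Ψ t))))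
  have m2 := mul_le_mul_of_nonneg_right (min_le_right (K⁻¹ / 2) (κ / 2)) hD
  rw [div_mul_eq_mul_div, le_div_iff₀ hc]
  linarith
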